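/- arXiv:1010.0535 — 7 statements merged into one kernel-verified Lean document; each statement's English description precedes it below -/
import Mathlib

section
/- Let μ be a finite signed Borel measure on X×Y with ∫b d|μ| < ∞ and ∫b'_a d|μ| < ∞ for every a ∈ (0,∞). Then for every f,h ∈ H the H-valued maps L'_f·Φ and L''_f·h·Φ are Bochner-integrable with respect to μ, and the maps Ã_f: C(X) → H, h ↦ ∫ L''_f h Φ dμ, and A_f: H → H, h ↦ ∫ L''_f h Φ dμ, are continuous linear operators. -/
open MeasureTheory Filter Classical
open scoped ENNReal Topology RealInnerProductSpace

/-- The Bochner integral of a vector-valued function with respect to a finite signed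
measure `μ`, defined as `∫ f dμ⁺ - ∫ f dμ⁻` via the Jordan decomposition of `μ`. -/
noncomputable def sintegral {α : Type*} [MeasurableSpace α] {E : Type*}
    [NormedAddCommGroup E] [NormedSpace ℝ E] (μ : SignedMeasure α) (f : α → E) : E :=
  (∫ a, f a ∂μ.toJordanDecomposition.posPart) - ∫ a, f a ∂μ.toJordanDecomposition.negPart

theorem svm_aux_null {α : Type*} [MeasurableSpace α] (μ : SignedMeasure α) (A : Set α)
    (hA : MeasurableSet A) (h : ∀ B : Set α, MeasurableSet B → B ⊆ A → μ B = 0) :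
    μ.totalVariation A = 0 := by
  obtain ⟨i, hi₁, hi₂, hi₃, hpos, hneg⟩ := μ.toJordanDecomposition_spec
  rw [SignedMeasure.totalVariation, Measure.add_apply, hpos, hneg,
    SignedMeasure.toMeasureOfZeroLE_apply _ _ _ hA,
    SignedMeasure.toMeasureOfLEZero_apply _ _ _ hA]
  simp [h _ (hi₁.inter hA) Set.inter_subset_right,
    h _ (hi₁.compl.inter hA) Set.inter_subset_right]

theorem svm_aux_integrable {α H : Type*} [MeasurableSpace α] [TopologicalSpace α]
    [OpensMeasurableSpace α] [SecondCountableTopology α]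
    [NormedAddCommGroup H] (ν : Measure α)
    (S : Set α) (hS : MeasurableSet S) (hν : ν Sᶜ = 0)
    (F : α → H) (hF : ContinuousOn F S) (β : α → ℝ) (hβ : Integrable β ν)
    (hb : ∀ z ∈ S, ‖F z‖ ≤ β z) : Integrable F ν := by
  have hae : ∀ᵐ z ∂ν, z ∈ S := by
    rw [ae_iff]; exact hν
  have hm : AEStronglyMeasurable F ν := by
    have := hF.aestronglyMeasurable (μ := ν) hS
    rwa [Measure.restrict_eq_self_of_ae_mem hae] at this
  exact hβ.mono' hm (hae.mono hb)

theorem svm_aux_operator {α H E : Type*} [MeasurableSpace α] [TopologicalSpace α]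
    [OpensMeasurableSpace α] [SecondCountableTopology α]
    [NormedAddCommGroup H] [NormedSpace ℝ H]
    [NormedAddCommGroup E] [NormedSpace ℝ E] (ν : Measure α) [IsFiniteMeasure ν]
    (S : Set α) (hS : MeasurableSet S) (hν : ν Sᶜ = 0)
    (F : E → α → H) (hF : ∀ g, ContinuousOn (F g) S)
    (hadd : ∀ g₁ g₂ z, F (g₁ + g₂) z = F g₁ z + F g₂ z)
    (hsmul : ∀ (c : ℝ) g z, F (c • g) z = c • F g z)
    (C : ℝ) (hb : ∀ g, ∀ z ∈ S, ‖F g z‖ ≤ C * ‖g‖) :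
    ∃ T : E →L[ℝ] H, ∀ g, T g = ∫ z, F g z ∂ν := by
  have hae : ∀ᵐ z ∂ν, z ∈ S := by
    rw [ae_iff]; exact hν
  have hint : ∀ g, Integrable (F g) ν := fun g =>
    svm_aux_integrable ν S hS hν (F g) (hF g) (fun _ => C * ‖g‖) (integrable_const _) (hb g)
  let T₀ : E →ₗ[ℝ] H :=
    { toFun := fun g => ∫ z, F g z ∂ν
      map_add' := fun g₁ g₂ => by
        simp only [hadd]
        exact integral_add (hint g₁) (hint g₂)
      map_smul' := fun c g => by
        simp only [hsmul, RingHom.id_apply]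
        exact integral_smul c _ }
  refine ⟨T₀.mkContinuous (C * ν.real Set.univ) fun g => ?_, fun g => rfl⟩
  have := norm_integral_le_of_norm_le_const (μ := ν) (hae.mono (hb g))
  calc ‖T₀ g‖ ≤ C * ‖g‖ * ν.real Set.univ := this
    _ = _ := by ring

theorem svm_aux_sintegral {α H E : Type*} [MeasurableSpace α] [TopologicalSpace α]
    [OpensMeasurableSpace α] [SecondCountableTopology α]
    [NormedAddCommGroup H] [NormedSpace ℝ H]
    [NormedAddCommGroup E] [NormedSpace ℝ E] (μ : SignedMeasure α)
    (S : Set α) (hS : MeasurableSet S) (hν : μ.totalVariation Sᶜ = 0)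
    (F : E → α → H) (hF : ∀ g, ContinuousOn (F g) S)
    (hadd : ∀ g₁ g₂ z, F (g₁ + g₂) z = F g₁ z + F g₂ z)
    (hsmul : ∀ (c : ℝ) g z, F (c • g) z = c • F g z)
    (C : ℝ) (hb : ∀ g, ∀ z ∈ S, ‖F g z‖ ≤ C * ‖g‖) :
    ∃ T : E →L[ℝ] H, ∀ g, T g = sintegral μ (F g) := by
  rw [SignedMeasure.totalVariation, Measure.add_apply, add_eq_zero] at hν
  obtain ⟨T₁, h₁⟩ := svm_aux_operator _ S hS hν.1 F hF hadd hsmul C hb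
  obtain ⟨T₂, h₂⟩ := svm_aux_operator _ S hS hν.2 F hF hadd hsmul C hb
  exact ⟨T₁ - T₂, fun g => by simp [sintegral, h₁, h₂]⟩

/-- **Integrability and the operators `Ã_f`, `A_f`** (Lemma 2 of the paper).
For a finite signed measure `μ` on `X × Y` with `∫ b d|μ| < ∞` and `∫ b'_a d|μ| < ∞` for
all `a > 0`, the maps `L'_f Φ` and `L''_f h Φ` are Bochner-integrable with respect to `μ`,
and `Ã_f : C(X) → H`, `h ↦ ∫ L''_f h Φ dμ` and `A_f : H → H`, `h ↦ ∫ L''_f h Φ dμ` are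
continuous linear operators. -/
theorem svm_integrability_and_operators
    (d : ℕ) (X : Set (EuclideanSpace ℝ (Fin d))) [CompactSpace X]
    (Y : Set ℝ) (hY : IsClosed Y)
    -- the separable RKHS `H` of a continuous bounded kernel, via its feature map `Φ`
    (H : Type) [NormedAddCommGroup H] [InnerProductSpace ℝ H] [CompleteSpace H]
    [TopologicalSpace.SeparableSpace H]
    (Φ : EuclideanSpace ℝ (Fin d) → H)
    (hΦcont : ContinuousOn Φ X)
    (κ : ℝ) (hΦbdd : ∀ x ∈ X, ‖Φ x‖ ≤ κ)
    -- the loss function and its partial derivatives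
    (L L' L'' : EuclideanSpace ℝ (Fin d) → ℝ → ℝ → ℝ)
    (hLmeas : Measurable (fun q : (EuclideanSpace ℝ (Fin d) × ℝ) × ℝ => L q.1.1 q.1.2 q.2))
    (hLnonneg : ∀ x ∈ X, ∀ y ∈ Y, ∀ t : ℝ, 0 ≤ L x y t)
    (hL' : ∀ x ∈ X, ∀ y ∈ Y, ∀ t : ℝ, HasDerivAt (L x y) (L' x y t) t)
    (hL'' : ∀ x ∈ X, ∀ y ∈ Y, ∀ t : ℝ, HasDerivAt (L' x y) (L'' x y t) t)
    (hL'cont : ContinuousOn (fun q : (EuclideanSpace ℝ (Fin d) × ℝ) × ℝ => L' q.1.1 q.1.2 q.2)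
      ((X ×ˢ Y) ×ˢ (Set.univ : Set ℝ)))
    (hL''cont : ContinuousOn (fun q : (EuclideanSpace ℝ (Fin d) × ℝ) × ℝ => L'' q.1.1 q.1.2 q.2)
      ((X ×ˢ Y) ×ˢ (Set.univ : Set ℝ)))
    -- the finite signed measure `μ`, concentrated on `X × Y`
    (μ : SignedMeasure (EuclideanSpace ℝ (Fin d) × ℝ))
    (hsupp : ∀ A : Set (EuclideanSpace ℝ (Fin d) × ℝ),
      MeasurableSet A → A ⊆ (X ×ˢ Y)ᶜ → μ A = 0)
    -- `∫ b d|μ| < ∞` for the Nemitski majorant `b` of `L`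
    (p : ℝ) (hp : 1 ≤ p)
    (b : EuclideanSpace ℝ (Fin d) × ℝ → ℝ)
    (hbint : Integrable b μ.totalVariation)
    (hNemitski : ∀ x ∈ X, ∀ y ∈ Y, ∀ t : ℝ, |L x y t| ≤ b (x, y) + |t| ^ p)
    -- `∫ b'_a d|μ| < ∞` for the envelopes of `L'`, with constant envelopes for `L''`
    (henv : ∀ a : ℝ, 0 < a → ∃ b' : EuclideanSpace ℝ (Fin d) × ℝ → ℝ, ∃ b'' : ℝ,
      Integrable b' μ.totalVariation ∧ 0 ≤ b'' ∧
      ∀ x ∈ X, ∀ y ∈ Y, ∀ t ∈ Set.Icc (-a) a, |L' x y t| ≤ b' (x, y) ∧ |L'' x y t| ≤ b'') :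
    -- `L'_f Φ` is Bochner-integrable with respect to `μ` …
    (∀ f : H, Integrable (fun z : EuclideanSpace ℝ (Fin d) × ℝ =>
        L' z.1 z.2 ⟪Φ z.1, f⟫ • Φ z.1) μ.totalVariation) ∧
    -- … and so is `L''_f h Φ` for every `h ∈ H` …
    (∀ f h : H, Integrable (fun z : EuclideanSpace ℝ (Fin d) × ℝ =>
        (L'' z.1 z.2 ⟪Φ z.1, f⟫ * ⟪Φ z.1, h⟫) • Φ z.1) μ.totalVariation) ∧
    -- … `Ã_f : C(X) → H` is a continuous linear operator …
    (∀ f : H, ∃ T : C(X, ℝ) →L[ℝ] H, ∀ g : C(X, ℝ),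
        T g = sintegral μ (fun z : EuclideanSpace ℝ (Fin d) × ℝ =>
          (L'' z.1 z.2 ⟪Φ z.1, f⟫ * (open scoped Classical in if hz : z.1 ∈ X then g ⟨z.1, hz⟩ else 0)) • Φ z.1)) ∧
    -- … and `A_f : H → H` is a continuous linear operator
    (∀ f : H, ∃ T : H →L[ℝ] H, ∀ h : H,
        T h = sintegral μ (fun z : EuclideanSpace ℝ (Fin d) × ℝ =>
          (L'' z.1 z.2 ⟪Φ z.1, f⟫ * ⟪Φ z.1, h⟫) • Φ z.1)) := by
  have hXc : IsCompact X := isCompact_iff_compactSpace.2 inferInstance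
  have hSm : MeasurableSet (X ×ˢ Y) := (hXc.isClosed.prod hY).measurableSet
  have hnull : μ.totalVariation (X ×ˢ Y)ᶜ = 0 := svm_aux_null μ _ hSm.compl hsupp
  obtain ⟨K, hK0, hK⟩ : ∃ K : ℝ, 0 ≤ K ∧ ∀ x ∈ X, ‖Φ x‖ ≤ K :=
    ⟨max κ 0, le_max_right _ _, fun x hx => (hΦbdd x hx).trans (le_max_left _ _)⟩
  have hΦS : ContinuousOn (fun z : EuclideanSpace ℝ (Fin d) × ℝ => Φ z.1) (X ×ˢ Y) :=
    hΦcont.comp continuousOn_fst fun z hz => hz.1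
  have hin : ∀ f : H, ContinuousOn
      (fun z : EuclideanSpace ℝ (Fin d) × ℝ => ⟪Φ z.1, f⟫) (X ×ˢ Y) := fun f =>
    hΦS.inner continuousOn_const
  have hinb : ∀ f : H, ∀ x ∈ X, |⟪Φ x, f⟫| ≤ K * ‖f‖ := fun f x hx =>
    (abs_real_inner_le_norm _ _).trans (mul_le_mul_of_nonneg_right (hK x hx) (norm_nonneg _))
  have hmap : ∀ f : H, Set.MapsTo
      (fun z : EuclideanSpace ℝ (Fin d) × ℝ => (z, ⟪Φ z.1, f⟫)) (X ×ˢ Y)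
      ((X ×ˢ Y) ×ˢ (Set.univ : Set ℝ)) := fun f z hz => ⟨hz, trivial⟩
  have hc1 : ∀ f : H, ContinuousOn
      (fun z : EuclideanSpace ℝ (Fin d) × ℝ => L' z.1 z.2 ⟪Φ z.1, f⟫) (X ×ˢ Y) := fun f =>
    hL'cont.comp (continuousOn_id.prodMk (hin f)) (hmap f)
  have hc2 : ∀ f : H, ContinuousOn
      (fun z : EuclideanSpace ℝ (Fin d) × ℝ => L'' z.1 z.2 ⟪Φ z.1, f⟫) (X ×ˢ Y) := fun f =>
    hL''cont.comp (continuousOn_id.prodMk (hin f)) (hmap f)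
  have hbd : ∀ f : H, ∃ b' : EuclideanSpace ℝ (Fin d) × ℝ → ℝ, ∃ b'' : ℝ,
      Integrable b' μ.totalVariation ∧ 0 ≤ b'' ∧ ∀ z ∈ X ×ˢ Y,
        |L' z.1 z.2 ⟪Φ z.1, f⟫| ≤ b' z ∧ |L'' z.1 z.2 ⟪Φ z.1, f⟫| ≤ b'' := by
    intro f
    have hpos : 0 < K * ‖f‖ + 1 := by positivity
    obtain ⟨b', b'', h1, h2, h3⟩ := henv _ hpos
    refine ⟨b', b'', h1, h2, fun z hz => h3 z.1 hz.1 z.2 hz.2 _ ?_⟩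
    exact abs_le.1 ((hinb f z.1 hz.1).trans (by linarith))
  have hF2 : ∀ f h : H, ContinuousOn (fun z : EuclideanSpace ℝ (Fin d) × ℝ =>
        (L'' z.1 z.2 ⟪Φ z.1, f⟫ * ⟪Φ z.1, h⟫) • Φ z.1) (X ×ˢ Y) := fun f h =>
    ((hc2 f).mul (hin h)).smul hΦS
  have hB2 : ∀ f : H, ∃ C : ℝ, ∀ h : H, ∀ z ∈ X ×ˢ Y,
      ‖(L'' z.1 z.2 ⟪Φ z.1, f⟫ * ⟪Φ z.1, h⟫) • Φ z.1‖ ≤ C * ‖h‖ := by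
    intro f
    obtain ⟨b', b'', h1, h2, h3⟩ := hbd f
    refine ⟨b'' * K * K, fun h z hz => ?_⟩
    rw [norm_smul, norm_mul, Real.norm_eq_abs, Real.norm_eq_abs]
    calc _ ≤ b'' * (K * ‖h‖) * K := by
          have e1 := (h3 z hz).2
          have e2 := hinb h z.1 hz.1
          have e3 := hK z.1 hz.1
          gcongr
      _ = _ := by ring
  refine ⟨fun f => ?_, fun f h => ?_, fun f => ?_, fun f => ?_⟩
  · obtain ⟨b', b'', h1, h2, h3⟩ := hbd f
    refine svm_aux_integrable _ _ hSm hnull _ ((hc1 f).smul hΦS) (fun z => b' z * K)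
      (h1.mul_const K) fun z hz => ?_
    have e1 := (h3 z hz).1
    have e0 : 0 ≤ b' z := (abs_nonneg _).trans e1
    have e3 := hK z.1 hz.1
    simp only [Pi.smul_apply', norm_smul, Real.norm_eq_abs]
    gcongr
  · obtain ⟨C, hC⟩ := hB2 f
    exact svm_aux_integrable _ _ hSm hnull _ (hF2 f h) (fun _ => C * ‖h‖)
      (integrable_const _) (hC h)
  · obtain ⟨b', b'', h1, h2, h3⟩ := hbd f
    refine svm_aux_sintegral μ _ hSm hnull (fun (g : C(X, ℝ)) (z : EuclideanSpace ℝ (Fin d) × ℝ) =>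
      (L'' z.1 z.2 ⟪Φ z.1, f⟫ * (if hz : z.1 ∈ X then g ⟨z.1, hz⟩ else 0)) • Φ z.1)
      (fun g => ?_) (fun g₁ g₂ z => ?_) (fun c g z => ?_) (b'' * K) fun g z hz => ?_
    · refine ((hc2 f).mul ?_).smul hΦS
      rw [continuousOn_iff_continuous_restrict]
      have : Continuous fun w : ↥(X ×ˢ Y) => g ⟨w.1.1, w.2.1⟩ := by fun_prop
      refine this.congr fun w => ?_
      have hw : w.1.1 ∈ X := w.2.1
      simp [Set.restrict, hw]
    · split_ifs <;> simp [mul_add, add_smul]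
    · split_ifs <;> simp [smul_smul]; ring_nf
    · have hx : z.1 ∈ X := hz.1
      simp only [hx, dite_true, norm_smul, norm_mul]
      have e1 := (h3 z hz).2
      have e2 := g.norm_coe_le_norm ⟨z.1, hx⟩
      have e3 := hK z.1 hz.1
      rw [← Real.norm_eq_abs] at e1
      calc _ ≤ b'' * ‖g‖ * K := by gcongr
        _ = _ := by ring
  · obtain ⟨C, hC⟩ := hB2 f
    refine svm_aux_sintegral μ _ hSm hnull (fun (h : H) (z : EuclideanSpace ℝ (Fin d) × ℝ) =>
      (L'' z.1 z.2 ⟪Φ z.1, f⟫ * ⟪Φ z.1, h⟫) • Φ z.1)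
      (hF2 f) (fun g₁ g₂ z => ?_) (fun c g z => ?_) C hC
    · simp [inner_add_right, mul_add, add_smul]
    · simp [inner_smul_right, smul_smul]; ring_nf
end

section
/- Let μ be a finite signed Borel measure on X×Y with ∫b d|μ| < ∞ and ∫b'_a d|μ| < ∞ for every a ∈ (0,∞). Then the map H → H, f ↦ ∫ L'_f Φ dμ, is Fréchet-differentiable, and its Fréchet derivative at f ∈ H is the continuous linear operator H → H, h ↦ ∫ L''_f h Φ dμ. -/
open MeasureTheory Filter Classical
open scoped ENNReal Topology RealInnerProductSpace

lemma svm_aux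
    (d : ℕ) (X : Set (EuclideanSpace ℝ (Fin d))) (hX : IsClosed X)
    (Y : Set ℝ) (hY : IsClosed Y)
    (H : Type) [NormedAddCommGroup H] [InnerProductSpace ℝ H] [CompleteSpace H]
    (Φ : EuclideanSpace ℝ (Fin d) → H)
    (hΦcont : ContinuousOn Φ X)
    (κ : ℝ) (hκ : 0 ≤ κ) (hΦbdd : ∀ x ∈ X, ‖Φ x‖ ≤ κ)
    (L' L'' : EuclideanSpace ℝ (Fin d) → ℝ → ℝ → ℝ)
    (hL'' : ∀ x ∈ X, ∀ y ∈ Y, ∀ t : ℝ, HasDerivAt (L' x y) (L'' x y t) t)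
    (hL'cont : ContinuousOn (fun q : (EuclideanSpace ℝ (Fin d) × ℝ) × ℝ => L' q.1.1 q.1.2 q.2)
      ((X ×ˢ Y) ×ˢ (Set.univ : Set ℝ)))
    (hL''cont : ContinuousOn (fun q : (EuclideanSpace ℝ (Fin d) × ℝ) × ℝ => L'' q.1.1 q.1.2 q.2)
      ((X ×ˢ Y) ×ˢ (Set.univ : Set ℝ)))
    (ν : Measure (EuclideanSpace ℝ (Fin d) × ℝ)) [IsFiniteMeasure ν]
    (hν : ∀ᵐ z ∂ν, z ∈ X ×ˢ Y)
    (henv : ∀ a : ℝ, 0 < a → ∃ b' : EuclideanSpace ℝ (Fin d) × ℝ → ℝ, ∃ b'' : ℝ,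
      Integrable b' ν ∧ 0 ≤ b'' ∧
      ∀ x ∈ X, ∀ y ∈ Y, ∀ t ∈ Set.Icc (-a) a, |L' x y t| ≤ b' (x, y) ∧ |L'' x y t| ≤ b'')
    (f : H) : ∃ D : H →L[ℝ] H,
      (∀ h : H, D h = ∫ z, (L'' z.1 z.2 ⟪Φ z.1, f⟫ * ⟪Φ z.1, h⟫) • Φ z.1 ∂ν) ∧
      HasFDerivAt (fun f' : H => ∫ z, L' z.1 z.2 ⟪Φ z.1, f'⟫ • Φ z.1 ∂ν) D f := by
  have hS : MeasurableSet (X ×ˢ Y) := (hX.prod hY).measurableSet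
  have hres : ν.restrict (X ×ˢ Y) = ν := Measure.restrict_eq_self_of_ae_mem hν
  obtain ⟨b', b'', hb', hb'', hb⟩ := henv (κ * (‖f‖ + 1) + 1) (by positivity)
  have hΦ1 : ContinuousOn (fun z : EuclideanSpace ℝ (Fin d) × ℝ => Φ z.1) (X ×ˢ Y) :=
    hΦcont.comp continuous_fst.continuousOn (fun z hz => hz.1)
  have hin : ∀ g : H, ContinuousOn (fun z : EuclideanSpace ℝ (Fin d) × ℝ => ⟪Φ z.1, g⟫) (X ×ˢ Y) :=
    fun g => hΦ1.inner continuousOn_const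
  have hpair : ∀ g : H, ContinuousOn
      (fun z : EuclideanSpace ℝ (Fin d) × ℝ => (z, ⟪Φ z.1, g⟫)) (X ×ˢ Y) :=
    fun g => continuousOn_id.prodMk (hin g)
  have hc1 : ∀ g : H, ContinuousOn
      (fun z : EuclideanSpace ℝ (Fin d) × ℝ => L' z.1 z.2 ⟪Φ z.1, g⟫) (X ×ˢ Y) :=
    fun g => hL'cont.comp (hpair g) (fun z hz => ⟨hz, Set.mem_univ _⟩)
  have hc2 : ∀ g : H, ContinuousOn
      (fun z : EuclideanSpace ℝ (Fin d) × ℝ => L'' z.1 z.2 ⟪Φ z.1, g⟫) (X ×ˢ Y) :=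
    fun g => hL''cont.comp (hpair g) (fun z hz => ⟨hz, Set.mem_univ _⟩)
  have hmem : ∀ g : H, ‖g‖ ≤ ‖f‖ + 1 → ∀ x ∈ X,
      ⟪Φ x, g⟫ ∈ Set.Icc (-(κ * (‖f‖ + 1) + 1)) (κ * (‖f‖ + 1) + 1) := by
    intro g hg x hx
    rw [Set.mem_Icc, ← abs_le]
    calc |⟪Φ x, g⟫| ≤ ‖Φ x‖ * ‖g‖ := abs_real_inner_le_norm _ _
      _ ≤ κ * (‖f‖ + 1) := by gcongr; exact hΦbdd x hx
      _ ≤ _ := by linarith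
  set F : H → EuclideanSpace ℝ (Fin d) × ℝ → H := fun g z => L' z.1 z.2 ⟪Φ z.1, g⟫ • Φ z.1 with hF
  set F' : H → EuclideanSpace ℝ (Fin d) × ℝ → (H →L[ℝ] H) := fun g z =>
    L'' z.1 z.2 ⟪Φ z.1, g⟫ • (innerSL ℝ (Φ z.1)).smulRight (Φ z.1) with hF'
  have hFm : ∀ g, AEStronglyMeasurable (F g) ν := by
    intro g
    rw [← hres]
    exact ((hc1 g).smul hΦ1).aestronglyMeasurable hS
  have hF'c : ContinuousOn (F' f) (X ×ˢ Y) := by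
    refine (hc2 f).smul ?_
    have h1 : ContinuousOn (fun z : EuclideanSpace ℝ (Fin d) × ℝ =>
        ContinuousLinearMap.smulRightL ℝ H H (innerSL ℝ (Φ z.1)) (Φ z.1)) (X ×ˢ Y) := by
      refine ContinuousOn.clm_apply ?_ hΦ1
      exact (ContinuousLinearMap.continuous _).comp_continuousOn
        ((innerSL ℝ).continuous.comp_continuousOn hΦ1)
    exact h1
  have hF'm : AEStronglyMeasurable (F' f) ν := by
    rw [← hres]
    exact hF'c.aestronglyMeasurable hS
  have hbound : ∀ z ∈ X ×ˢ Y, ∀ g : H, ‖g‖ ≤ ‖f‖ + 1 → ‖F' g z‖ ≤ b'' * (κ * κ) := by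
    intro z hz g hg
    simp only [hF', norm_smul, ContinuousLinearMap.norm_smulRight_apply, innerSL_apply_norm]
    have h1 := (hb z.1 hz.1 z.2 hz.2 _ (hmem g hg z.1 hz.1)).2
    have h2 := hΦbdd z.1 hz.1
    rw [Real.norm_eq_abs]
    gcongr
  have hF'i : Integrable (F' f) ν := by
    refine Integrable.of_bound hF'm (b'' * (κ * κ)) ?_
    filter_upwards [hν] with z hz
    exact hbound z hz f (by linarith)
  have hFi : Integrable (F f) ν := by
    refine Integrable.mono' (hb'.mul_const κ) (hFm f) ?_
    filter_upwards [hν] with z hz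
    simp only [hF, norm_smul, Real.norm_eq_abs]
    have h1 := (hb z.1 hz.1 z.2 hz.2 _ (hmem f (by linarith) z.1 hz.1)).1
    have h2 := hΦbdd z.1 hz.1
    exact mul_le_mul h1 h2 (norm_nonneg _) ((abs_nonneg _).trans h1)
  refine ⟨∫ z, F' f z ∂ν, ?_, ?_⟩
  · intro h
    rw [ContinuousLinearMap.integral_apply hF'i]
    refine integral_congr_ae (Eventually.of_forall fun z => ?_)
    simp [hF', smul_smul]
  · refine hasFDerivAt_integral_of_dominated_of_fderiv_le (F := F) (F' := F')
      (bound := fun _ => b'' * (κ * κ)) (Metric.ball_mem_nhds f one_pos)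
      (Eventually.of_forall hFm) hFi hF'm ?_ (integrable_const _) ?_
    · filter_upwards [hν] with z hz g hg
      refine hbound z hz g ?_
      have h1 : ‖g - f‖ < 1 := by simpa [dist_eq_norm] using hg
      have h2 := norm_le_norm_add_norm_sub' g f
      linarith
    · filter_upwards [hν] with z hz g hg
      have h1 : HasFDerivAt (fun g : H => ⟪Φ z.1, g⟫) (innerSL ℝ (Φ z.1)) g :=
        (innerSL ℝ (Φ z.1)).hasFDerivAt
      have h2 := ((hL'' z.1 hz.1 z.2 hz.2 ⟪Φ z.1, g⟫).comp_hasFDerivAt g h1).smul_const (Φ z.1)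
      refine h2.congr_fderiv ?_
      ext h
      simp [hF', smul_smul]

lemma svm_support {α : Type*} [MeasurableSpace α] (μ : SignedMeasure α) (S : Set α)
    (hS : MeasurableSet S)
    (hsupp : ∀ A : Set α, MeasurableSet A → A ⊆ Sᶜ → μ A = 0) :
    (∀ᵐ z ∂μ.toJordanDecomposition.posPart, z ∈ S) ∧
    (∀ᵐ z ∂μ.toJordanDecomposition.negPart, z ∈ S) := by
  obtain ⟨i, hi, h1, h2, h3, h4⟩ := μ.toJordanDecomposition_spec
  constructor
  · rw [ae_iff, h3]
    rw [SignedMeasure.toMeasureOfZeroLE_apply _ h1 hi (by exact hS.compl)]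
    have := hsupp (i ∩ Sᶜ) (hi.inter hS.compl) Set.inter_subset_right
    simp only [ENNReal.coe_eq_zero]
    exact NNReal.eq this
  · rw [ae_iff, h4]
    rw [SignedMeasure.toMeasureOfLEZero_apply _ h2 hi.compl (by exact hS.compl)]
    have := hsupp (iᶜ ∩ Sᶜ) (hi.compl.inter hS.compl) Set.inter_subset_right
    simp only [ENNReal.coe_eq_zero]
    refine NNReal.eq ?_
    change -μ (iᶜ ∩ Sᶜ) = 0
    rw [this, neg_zero]

/-- **Fréchet differentiability of the derivative of the generalized risk**
(Lemma 3(b) of the paper). For a finite signed measure `μ` on `X × Y` with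
`∫ b d|μ| < ∞` and `∫ b'_a d|μ| < ∞` for all `a > 0`, the map `f ↦ ∫ L'_f Φ dμ`,
`H → H`, is Fréchet-differentiable with derivative `h ↦ ∫ L''_f h Φ dμ` at `f`. -/
theorem svm_risk_derivative_frechet_differentiable
    (d : ℕ) (X : Set (EuclideanSpace ℝ (Fin d))) [CompactSpace X]
    (Y : Set ℝ) (hY : IsClosed Y)
    -- the separable RKHS `H` of a continuous bounded kernel, via its feature map `Φ`
    (H : Type) [NormedAddCommGroup H] [InnerProductSpace ℝ H] [CompleteSpace H]
    [TopologicalSpace.SeparableSpace H]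
    (Φ : EuclideanSpace ℝ (Fin d) → H)
    (hΦcont : ContinuousOn Φ X)
    (κ : ℝ) (hΦbdd : ∀ x ∈ X, ‖Φ x‖ ≤ κ)
    -- the loss function and its partial derivatives
    (L L' L'' : EuclideanSpace ℝ (Fin d) → ℝ → ℝ → ℝ)
    (hLmeas : Measurable (fun q : (EuclideanSpace ℝ (Fin d) × ℝ) × ℝ => L q.1.1 q.1.2 q.2))
    (hLnonneg : ∀ x ∈ X, ∀ y ∈ Y, ∀ t : ℝ, 0 ≤ L x y t)
    (hL' : ∀ x ∈ X, ∀ y ∈ Y, ∀ t : ℝ, HasDerivAt (L x y) (L' x y t) t)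
    (hL'' : ∀ x ∈ X, ∀ y ∈ Y, ∀ t : ℝ, HasDerivAt (L' x y) (L'' x y t) t)
    (hL'cont : ContinuousOn (fun q : (EuclideanSpace ℝ (Fin d) × ℝ) × ℝ => L' q.1.1 q.1.2 q.2)
      ((X ×ˢ Y) ×ˢ (Set.univ : Set ℝ)))
    (hL''cont : ContinuousOn (fun q : (EuclideanSpace ℝ (Fin d) × ℝ) × ℝ => L'' q.1.1 q.1.2 q.2)
      ((X ×ˢ Y) ×ˢ (Set.univ : Set ℝ)))
    -- the finite signed measure `μ`, concentrated on `X × Y`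
    (μ : SignedMeasure (EuclideanSpace ℝ (Fin d) × ℝ))
    (hsupp : ∀ A : Set (EuclideanSpace ℝ (Fin d) × ℝ),
      MeasurableSet A → A ⊆ (X ×ˢ Y)ᶜ → μ A = 0)
    -- `∫ b d|μ| < ∞` for the Nemitski majorant `b` of `L`
    (p : ℝ) (hp : 1 ≤ p)
    (b : EuclideanSpace ℝ (Fin d) × ℝ → ℝ)
    (hbint : Integrable b μ.totalVariation)
    (hNemitski : ∀ x ∈ X, ∀ y ∈ Y, ∀ t : ℝ, |L x y t| ≤ b (x, y) + |t| ^ p)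
    -- `∫ b'_a d|μ| < ∞` for the envelopes of `L'`, with constant envelopes for `L''`
    (henv : ∀ a : ℝ, 0 < a → ∃ b' : EuclideanSpace ℝ (Fin d) × ℝ → ℝ, ∃ b'' : ℝ,
      Integrable b' μ.totalVariation ∧ 0 ≤ b'' ∧
      ∀ x ∈ X, ∀ y ∈ Y, ∀ t ∈ Set.Icc (-a) a, |L' x y t| ≤ b' (x, y) ∧ |L'' x y t| ≤ b'')
    :
    ∀ f : H, ∃ D : H →L[ℝ] H,
      (∀ h : H, D h = sintegral μ (fun z : EuclideanSpace ℝ (Fin d) × ℝ =>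
          (L'' z.1 z.2 ⟪Φ z.1, f⟫ * ⟪Φ z.1, h⟫) • Φ z.1)) ∧
      HasFDerivAt (fun f' : H =>
        sintegral μ (fun z : EuclideanSpace ℝ (Fin d) × ℝ =>
          L' z.1 z.2 ⟪Φ z.1, f'⟫ • Φ z.1)) D f := by
  intro f
  have hX : IsClosed X := (isCompact_iff_compactSpace.mpr inferInstance).isClosed
  have hS : MeasurableSet (X ×ˢ Y) := (hX.prod hY).measurableSet
  obtain ⟨hp1, hn1⟩ := svm_support μ (X ×ˢ Y) hS hsupp
  have hlep : μ.toJordanDecomposition.posPart ≤ μ.totalVariation :=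
    Measure.le_add_right le_rfl
  have hlen : μ.toJordanDecomposition.negPart ≤ μ.totalVariation :=
    Measure.le_add_left le_rfl
  have key := fun (ν : Measure (EuclideanSpace ℝ (Fin d) × ℝ)) (_ : IsFiniteMeasure ν)
      (hν : ∀ᵐ z ∂ν, z ∈ X ×ˢ Y) (hle : ν ≤ μ.totalVariation) =>
    svm_aux d X hX Y hY H Φ hΦcont |κ| (abs_nonneg _)
      (fun x hx => (hΦbdd x hx).trans (le_abs_self _)) L' L'' hL'' hL'cont hL''cont ν hν
      (fun a ha => by
        obtain ⟨b', b'', h1, h2⟩ := henv a ha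
        exact ⟨b', b'', h1.mono_measure hle, h2⟩) f
  obtain ⟨D1, hD1, hD1'⟩ := key _ inferInstance hp1 hlep
  obtain ⟨D2, hD2, hD2'⟩ := key _ inferInstance hn1 hlen
  refine ⟨D1 - D2, fun h => ?_, hD1'.sub hD2'⟩
  rw [ContinuousLinearMap.sub_apply, hD1, hD2]
  rfl
end

section
/- Let μ be a nonzero finite (positive) Borel measure on X×Y with ∫b dμ < ∞ and ∫b'_a dμ < ∞ for every a ∈ (0,∞), and let f_μ = f_{L,μ,λ₀} be the unique minimizer in H of f ↦ ∫L(x,y,f(x)) dμ + λ₀‖f‖²_H. Then the map K: H → H, f ↦ 2λ₀ f + ∫ L''_{f_μ} f Φ dμ, is a continuous linear operator which is invertible (a bijection with continuous inverse). -/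
open MeasureTheory Filter Classical
open scoped ENNReal Topology RealInnerProductSpace

/-- **Invertibility of the operator `K_F`** (Lemma 6 of the paper). For a nonzero finite
measure `μ` on `X × Y` with `∫ b dμ < ∞` and `∫ b'_a dμ < ∞` for all `a > 0`, and
`f_μ = f_{L,μ,λ₀}` the SVM for `μ`, the map `K : H → H`,
`f ↦ 2λ₀ f + ∫ L''_{f_μ} f Φ dμ`, is an invertible continuous linear operator. -/
theorem svm_operator_K_invertible
    (d : ℕ) (X : Set (EuclideanSpace ℝ (Fin d))) [CompactSpace X]
    (Y : Set ℝ) (hY : IsClosed Y)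
    -- the separable RKHS `H` of a continuous bounded kernel, via its feature map `Φ`
    (H : Type) [NormedAddCommGroup H] [InnerProductSpace ℝ H] [CompleteSpace H]
    [TopologicalSpace.SeparableSpace H]
    (Φ : EuclideanSpace ℝ (Fin d) → H)
    (hΦcont : ContinuousOn Φ X)
    (κ : ℝ) (hΦbdd : ∀ x ∈ X, ‖Φ x‖ ≤ κ)
    (lam0 : ℝ) (hlam0 : 0 < lam0)
    -- the loss function, convex in its third argument, and its partial derivatives
    (L L' L'' : EuclideanSpace ℝ (Fin d) → ℝ → ℝ → ℝ)
    (hLmeas : Measurable (fun q : (EuclideanSpace ℝ (Fin d) × ℝ) × ℝ => L q.1.1 q.1.2 q.2))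
    (hLnonneg : ∀ x ∈ X, ∀ y ∈ Y, ∀ t : ℝ, 0 ≤ L x y t)
    (hLconvex : ∀ x ∈ X, ∀ y ∈ Y, ConvexOn ℝ Set.univ (L x y))
    (hL' : ∀ x ∈ X, ∀ y ∈ Y, ∀ t : ℝ, HasDerivAt (L x y) (L' x y t) t)
    (hL'' : ∀ x ∈ X, ∀ y ∈ Y, ∀ t : ℝ, HasDerivAt (L' x y) (L'' x y t) t)
    (hL'cont : ContinuousOn (fun q : (EuclideanSpace ℝ (Fin d) × ℝ) × ℝ => L' q.1.1 q.1.2 q.2)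
      ((X ×ˢ Y) ×ˢ (Set.univ : Set ℝ)))
    (hL''cont : ContinuousOn (fun q : (EuclideanSpace ℝ (Fin d) × ℝ) × ℝ => L'' q.1.1 q.1.2 q.2)
      ((X ×ˢ Y) ×ˢ (Set.univ : Set ℝ)))
    -- the nonzero finite measure `μ` on `X × Y` and its integrability properties
    (μ : Measure (EuclideanSpace ℝ (Fin d) × ℝ)) [IsFiniteMeasure μ]
    (hμne : μ ≠ 0)
    (hsupp : μ ((X ×ˢ Y)ᶜ) = 0)
    (p : ℝ) (hp : 1 ≤ p)
    (b : EuclideanSpace ℝ (Fin d) × ℝ → ℝ)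
    (hbint : Integrable b μ)
    (hNemitski : ∀ x ∈ X, ∀ y ∈ Y, ∀ t : ℝ, |L x y t| ≤ b (x, y) + |t| ^ p)
    (henv : ∀ a : ℝ, 0 < a → ∃ b' : EuclideanSpace ℝ (Fin d) × ℝ → ℝ, ∃ b'' : ℝ,
      Integrable b' μ ∧ 0 ≤ b'' ∧
      ∀ x ∈ X, ∀ y ∈ Y, ∀ t ∈ Set.Icc (-a) a, |L' x y t| ≤ b' (x, y) ∧ |L'' x y t| ≤ b'')
    -- `f_μ` is the SVM for `μ`, i.e. the minimizer of the `μ`-regularized risk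
    (fμ : H)
    (hfμ : ∀ g : H,
      (∫ z, L z.1 z.2 ⟪Φ z.1, fμ⟫ ∂μ) + lam0 * ‖fμ‖ ^ 2 ≤
      (∫ z, L z.1 z.2 ⟪Φ z.1, g⟫ ∂μ) + lam0 * ‖g‖ ^ 2) :
    -- conclusion: `f ↦ 2λ₀ f + ∫ L''_{f_μ} f Φ dμ` is an invertible continuous linear operator
    ∃ K : H ≃L[ℝ] H, ∀ f : H,
      K f = (2 * lam0) • f +
        ∫ z, (L'' z.1 z.2 ⟪Φ z.1, fμ⟫ * ⟪Φ z.1, f⟫) • Φ z.1 ∂μ := by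
  have hXc : IsCompact X := isCompact_iff_compactSpace.mpr inferInstance
  have hS : MeasurableSet (X ×ˢ Y) := (hXc.isClosed.prod hY).measurableSet
  have hae : ∀ᵐ z ∂μ, z ∈ X ×ˢ Y := by
    rw [ae_iff]; exact hsupp
  have hres : μ.restrict (X ×ˢ Y) = μ := Measure.restrict_eq_self_of_ae_mem hae
  have hΦ1 : ContinuousOn (fun z : EuclideanSpace ℝ (Fin d) × ℝ => Φ z.1) (X ×ˢ Y) :=
    hΦcont.comp continuous_fst.continuousOn (fun z hz => hz.1)
  have hin : ContinuousOn (fun z : EuclideanSpace ℝ (Fin d) × ℝ => ⟪Φ z.1, fμ⟫) (X ×ˢ Y) :=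
    hΦ1.inner continuousOn_const
  have hLc : ContinuousOn
      (fun z : EuclideanSpace ℝ (Fin d) × ℝ => L'' z.1 z.2 ⟪Φ z.1, fμ⟫) (X ×ˢ Y) :=
    hL''cont.comp (f := fun z : EuclideanSpace ℝ (Fin d) × ℝ => (z, ⟪Φ z.1, fμ⟫))
      (continuousOn_id.prodMk hin) (fun z hz => ⟨hz, Set.mem_univ _⟩)
  have hnn : ∀ x ∈ X, ∀ y ∈ Y, ∀ t, 0 ≤ L'' x y t := by
    intro x hx y hy t
    have hm : Monotone (L' x y) := by
      intro s u hsu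
      have h := (hLconvex x hx y hy).monotoneOn_derivWithin
        (fun z _ => ((hL' x hx y hy z).differentiableAt).differentiableWithinAt)
        (Set.mem_univ s) (Set.mem_univ u) hsu
      simpa [derivWithin_univ, (hL' x hx y hy _).deriv] using h
    rw [← (hL'' x hx y hy t).deriv]
    exact hm.deriv_nonneg
  obtain ⟨b', b'', -, hb0, hb⟩ := henv (|κ| * ‖fμ‖ + 1) (by positivity)
  have hbd : ∀ x ∈ X, ∀ y ∈ Y, |L'' x y ⟪Φ x, fμ⟫| ≤ b'' := by
    intro x hx y hy
    refine (hb x hx y hy _ ?_).2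
    rw [Set.mem_Icc, ← abs_le]
    have h1 := abs_real_inner_le_norm (Φ x) fμ
    have h2 : ‖Φ x‖ * ‖fμ‖ ≤ |κ| * ‖fμ‖ := by
      gcongr; exact (hΦbdd x hx).trans (le_abs_self κ)
    linarith
  let G : EuclideanSpace ℝ (Fin d) × ℝ → (H →L[ℝ] H) := fun z =>
    L'' z.1 z.2 ⟪Φ z.1, fμ⟫ • ContinuousLinearMap.smulRightL ℝ H H (innerSL ℝ (Φ z.1)) (Φ z.1)
  have hGc : ContinuousOn G (X ×ˢ Y) := by
    refine hLc.smul ?_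
    exact ((ContinuousLinearMap.continuous _).comp_continuousOn
      ((innerSL ℝ).continuous.comp_continuousOn hΦ1)).clm_apply hΦ1
  have hGm : AEStronglyMeasurable G μ := by
    rw [← hres]; exact hGc.aestronglyMeasurable hS
  have hGi : Integrable G μ := by
    refine Integrable.of_bound hGm (b'' * (|κ| * |κ|)) ?_
    filter_upwards [hae] with z hz
    have hk := (hΦbdd z.1 hz.1).trans (le_abs_self κ)
    have h1 := hbd z.1 hz.1 z.2 hz.2
    simp only [G, norm_smul, Real.norm_eq_abs]
    gcongr
    rw [ContinuousLinearMap.smulRightL_apply_apply, ContinuousLinearMap.norm_smulRight_apply,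
      innerSL_apply_norm]
    gcongr
  have hGa : ∀ z f, G z f = (L'' z.1 z.2 ⟪Φ z.1, fμ⟫ * ⟪Φ z.1, f⟫) • Φ z.1 := by
    intro z f
    simp [G, smul_smul]
  let A : H →L[ℝ] H := ∫ z, G z ∂μ
  have hA : ∀ f, A f = ∫ z, (L'' z.1 z.2 ⟪Φ z.1, fμ⟫ * ⟪Φ z.1, f⟫) • Φ z.1 ∂μ := by
    intro f
    simp only [A, ContinuousLinearMap.integral_apply hGi, hGa]
  have hApos : ∀ f, 0 ≤ ⟪A f, f⟫ := by
    intro f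
    have hi : Integrable (fun z => G z f) μ := hGi.apply_continuousLinearMap f
    simp only [A, ContinuousLinearMap.integral_apply hGi]
    rw [real_inner_comm, ← integral_inner hi]
    refine integral_nonneg_of_ae ?_
    filter_upwards [hae] with z hz
    have h0 := hnn z.1 hz.1 z.2 hz.2 ⟪Φ z.1, fμ⟫
    rw [hGa, inner_smul_right, real_inner_comm (Φ z.1) f, mul_assoc]
    exact mul_nonneg h0 (mul_self_nonneg _)
  let K : H →L[ℝ] H := (2 * lam0) • ContinuousLinearMap.id ℝ H + A
  let B : H →L[ℝ] H →L[ℝ] ℝ := (innerSL ℝ).comp K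
  have hB : ∀ f g, B f g = ⟪K f, g⟫ := fun f g => rfl
  have hco : IsCoercive B := by
    refine ⟨2 * lam0, by positivity, fun f => ?_⟩
    rw [hB]
    simp only [K, ContinuousLinearMap.add_apply, ContinuousLinearMap.smul_apply,
      ContinuousLinearMap.id_apply, inner_add_left, inner_smul_left, real_inner_self_eq_norm_mul_norm]
    have := hApos f
    simp only [conj_trivial]
    linarith
  refine ⟨hco.continuousLinearEquivOfBilin, fun f => ?_⟩
  rw [← hA]
  refine ext_inner_right ℝ fun g => ?_
  rw [hco.continuousLinearEquivOfBilin_apply, hB]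
  rfl
end

section
/- Let μ be a finite signed Borel measure on X×Y with ∫b'_a d|μ| < ∞ for every a ∈ (0,∞). Then for every f ∈ H the continuous linear operator A_f: H → H, h ↦ ∫ L''_f h Φ dμ, is a compact operator. -/
open MeasureTheory Filter Classical
open scoped ENNReal Topology RealInnerProductSpace

lemma aux_one {α : Type*} [TopologicalSpace α] [MeasurableSpace α] [BorelSpace α]
    [SecondCountableTopology α]
    {H : Type} [NormedAddCommGroup H] [InnerProductSpace ℝ H] [CompleteSpace H]
    (ν : Measure α) [IsFiniteMeasure ν] (S : Set α) (hS : MeasurableSet S) (hν : ν Sᶜ = 0)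
    (g : α → ℝ) (P : α → H) (hg : ContinuousOn g S) (hP : ContinuousOn P S)
    (C κ : ℝ) (hgb : ∀ z ∈ S, |g z| ≤ C) (hPb : ∀ z ∈ S, ‖P z‖ ≤ κ) :
    ∃ T : H →L[ℝ] H, (∀ h, T h = ∫ z, (g z * ⟪P z, h⟫) • P z ∂ν) ∧ IsCompactOperator T := by
  let K : Submodule ℝ (H →L[ℝ] H) := compactOperator (RingHom.id ℝ) H H
  have hKc : IsClosed (K : Set (H →L[ℝ] H)) := isClosed_setOf_isCompactOperator
  haveI : CompleteSpace K := hKc.completeSpace_coe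
  let F : α → (H →L[ℝ] H) := fun z => g z • (innerSL ℝ (P z)).smulRight (P z)
  have hFK : ∀ z, F z ∈ K := by
    intro z
    refine K.smul_mem _ ?_
    change IsCompactOperator ((innerSL ℝ (P z)).smulRight (P z))
    have h1 : IsCompactOperator (innerSL ℝ (P z)) :=
      ⟨Metric.closedBall 0 1, isCompact_closedBall _ _,
        (innerSL ℝ (P z)).continuous.continuousAt.preimage_mem_nhds
          (by simpa using Metric.closedBall_mem_nhds (0 : ℝ) one_pos)⟩
    exact h1.clm_comp (ContinuousLinearMap.toSpanSingleton ℝ (P z))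
  have hFc : ContinuousOn F S := by
    refine hg.smul ?_
    have : Continuous (fun p : H => (innerSL ℝ p).smulRight p) := by
      exact (((ContinuousLinearMap.smulRightL ℝ H H).continuous.comp
        (innerSL ℝ).continuous).clm_apply continuous_id)
    exact this.comp_continuousOn hP
  let G : α → K := fun z => ⟨F z, hFK z⟩
  have hGc : ContinuousOn G S := by
    rw [continuousOn_iff_continuous_restrict] at hFc ⊢
    exact hFc.subtype_mk _
  have hae : ∀ᵐ z ∂ν, z ∈ S := by
    rw [ae_iff]; exact hν
  have hres : ν.restrict S = ν := Measure.restrict_eq_self_of_ae_mem hae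
  have hGm : AEStronglyMeasurable G ν := by
    rw [← hres]; exact hGc.aestronglyMeasurable hS
  have hGi : Integrable G ν := by
    refine Integrable.of_bound hGm (C * (κ * κ)) ?_
    filter_upwards [hae] with z hz
    change ‖F z‖ ≤ _
    have h1 := hgb z hz
    have h2 := hPb z hz
    have h0 := norm_nonneg (P z)
    simp only [F, norm_smul, ContinuousLinearMap.norm_smulRight_apply, innerSL_apply_norm,
      Real.norm_eq_abs]
    have := abs_nonneg (g z)
    have hκ : 0 ≤ κ := h0.trans h2
    have hC : 0 ≤ C := this.trans h1
    gcongr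
  refine ⟨((∫ z, G z ∂ν : K) : H →L[ℝ] H), fun h => ?_, (∫ z, G z ∂ν : K).2⟩
  let ψ : K →L[ℝ] H := (ContinuousLinearMap.apply ℝ H h).comp K.subtypeL
  have := ContinuousLinearMap.integral_comp_comm (𝕜 := ℝ) (Fₗ := H) ψ hGi
  simp only [ψ, ContinuousLinearMap.comp_apply, Submodule.subtypeL_apply,
    ContinuousLinearMap.apply_apply] at this
  refine this.symm.trans ?_
  refine integral_congr_ae (Eventually.of_forall fun z => ?_)
  simp [G, F, smul_smul]

lemma aux_null {α : Type*} [MeasurableSpace α] (μ : SignedMeasure α) (B : Set α)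
    (hB : MeasurableSet B) (h : ∀ A, MeasurableSet A → A ⊆ B → μ A = 0) :
    μ.toJordanDecomposition.posPart B = 0 ∧ μ.toJordanDecomposition.negPart B = 0 := by
  obtain ⟨i, hi, h1, h2, h3, h4⟩ := μ.toJordanDecomposition_spec
  rw [h3, h4, SignedMeasure.toMeasureOfZeroLE_apply _ _ _ hB,
    SignedMeasure.toMeasureOfLEZero_apply _ _ _ hB]
  have e1 := h _ (hi.inter hB) Set.inter_subset_right
  have e2 := h _ (hi.compl.inter hB) Set.inter_subset_right
  constructor
  · simp only [ENNReal.coe_eq_zero]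
    exact Subtype.ext e1
  · simp only [ENNReal.coe_eq_zero]
    exact Subtype.ext (by simp [e2])

/-- **Compactness of the operator `A_f`** (part (ii) of the proof of Lemma 6 of the paper).
For a finite signed measure `μ` on `X × Y` with `∫ b'_a d|μ| < ∞` for all `a > 0`,
the continuous linear operator `A_f : H → H`, `h ↦ ∫ L''_f h Φ dμ`, is compact. -/
theorem svm_operator_A_compact
    (d : ℕ) (X : Set (EuclideanSpace ℝ (Fin d))) [CompactSpace X]
    (Y : Set ℝ) (hY : IsClosed Y)
    -- the separable RKHS `H` of a continuous bounded kernel, via its feature map `Φ`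
    (H : Type) [NormedAddCommGroup H] [InnerProductSpace ℝ H] [CompleteSpace H]
    [TopologicalSpace.SeparableSpace H]
    (Φ : EuclideanSpace ℝ (Fin d) → H)
    (hΦcont : ContinuousOn Φ X)
    (κ : ℝ) (hΦbdd : ∀ x ∈ X, ‖Φ x‖ ≤ κ)
    -- the loss function and its partial derivatives
    (L L' L'' : EuclideanSpace ℝ (Fin d) → ℝ → ℝ → ℝ)
    (hLmeas : Measurable (fun q : (EuclideanSpace ℝ (Fin d) × ℝ) × ℝ => L q.1.1 q.1.2 q.2))
    (hLnonneg : ∀ x ∈ X, ∀ y ∈ Y, ∀ t : ℝ, 0 ≤ L x y t)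
    (hL' : ∀ x ∈ X, ∀ y ∈ Y, ∀ t : ℝ, HasDerivAt (L x y) (L' x y t) t)
    (hL'' : ∀ x ∈ X, ∀ y ∈ Y, ∀ t : ℝ, HasDerivAt (L' x y) (L'' x y t) t)
    (hL'cont : ContinuousOn (fun q : (EuclideanSpace ℝ (Fin d) × ℝ) × ℝ => L' q.1.1 q.1.2 q.2)
      ((X ×ˢ Y) ×ˢ (Set.univ : Set ℝ)))
    (hL''cont : ContinuousOn (fun q : (EuclideanSpace ℝ (Fin d) × ℝ) × ℝ => L'' q.1.1 q.1.2 q.2)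
      ((X ×ˢ Y) ×ˢ (Set.univ : Set ℝ)))
    -- the finite signed measure `μ` on `X × Y`
    (μtv : SignedMeasure (EuclideanSpace ℝ (Fin d) × ℝ))
    (hsupp : ∀ A : Set (EuclideanSpace ℝ (Fin d) × ℝ),
      MeasurableSet A → A ⊆ (X ×ˢ Y)ᶜ → μtv A = 0)
    -- envelope conditions for `L'` and `L''`
    (henv : ∀ a : ℝ, 0 < a → ∃ b' : EuclideanSpace ℝ (Fin d) × ℝ → ℝ, ∃ b'' : ℝ,
      Integrable b' μtv.totalVariation ∧ 0 ≤ b'' ∧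
      ∀ x ∈ X, ∀ y ∈ Y, ∀ t ∈ Set.Icc (-a) a, |L' x y t| ≤ b' (x, y) ∧ |L'' x y t| ≤ b'') :
    -- conclusion: every `A_f` is a compact operator
    ∀ f : H, ∃ T : H →L[ℝ] H,
      (∀ h : H, T h = sintegral μtv (fun z : EuclideanSpace ℝ (Fin d) × ℝ =>
        (L'' z.1 z.2 ⟪Φ z.1, f⟫ * ⟪Φ z.1, h⟫) • Φ z.1)) ∧
      IsCompactOperator T := by
  intro f
  have hX : IsCompact X := isCompact_iff_compactSpace.mpr inferInstance
  have hS : MeasurableSet (X ×ˢ Y) := hX.measurableSet.prod hY.measurableSet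
  obtain ⟨n1, n2⟩ := aux_null μtv _ hS.compl hsupp
  have ha : 0 < |κ| * ‖f‖ + 1 := by positivity
  obtain ⟨b', b'', -, -, hb⟩ := henv _ ha
  have hP : ContinuousOn (fun z : EuclideanSpace ℝ (Fin d) × ℝ => Φ z.1) (X ×ˢ Y) :=
    hΦcont.comp continuousOn_fst fun z hz => hz.1
  have hg : ContinuousOn (fun z : EuclideanSpace ℝ (Fin d) × ℝ => L'' z.1 z.2 ⟪Φ z.1, f⟫)
      (X ×ˢ Y) := by
    have : ContinuousOn (fun z : EuclideanSpace ℝ (Fin d) × ℝ => (z, (⟪Φ z.1, f⟫ : ℝ)))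
      (X ×ˢ Y) := continuousOn_id.prodMk (hP.inner continuousOn_const)
    exact hL''cont.comp this fun z hz => ⟨hz, trivial⟩
  have hgb : ∀ z ∈ X ×ˢ Y, |L'' z.1 z.2 ⟪Φ z.1, f⟫| ≤ b'' := by
    intro z hz
    refine (hb z.1 hz.1 z.2 hz.2 _ ?_).2
    rw [Set.mem_Icc, ← abs_le]
    have h1 := abs_real_inner_le_norm (Φ z.1) f
    have h2 : ‖Φ z.1‖ * ‖f‖ ≤ |κ| * ‖f‖ := by
      gcongr
      exact (hΦbdd _ hz.1).trans (le_abs_self _)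
    linarith
  have hPb : ∀ z ∈ X ×ˢ Y, ‖Φ z.1‖ ≤ κ := fun z hz => hΦbdd _ hz.1
  obtain ⟨T1, hT1, c1⟩ := aux_one μtv.toJordanDecomposition.posPart _ hS n1 _ _ hg hP _ _ hgb hPb
  obtain ⟨T2, hT2, c2⟩ := aux_one μtv.toJordanDecomposition.negPart _ hS n2 _ _ hg hP _ _ hgb hPb
  refine ⟨T1 - T2, fun h => ?_, c1.sub c2⟩
  simp only [ContinuousLinearMap.sub_apply, hT1, hT2, sintegral]
end

section
/- Let ν be a nonzero finite (positive) Borel measure on X×Y and μ a finite signed Borel measure on X×Y, both satisfying ∫b d|·| < ∞ and ∫b'_a d|·| < ∞ for all a ∈ (0,∞), and let ρ > 0 be such that ν + sμ is a nonzero finite (positive) measure for every s ∈ (−ρ,ρ). Let f_ν = f_{L,ν,λ₀} and let K: H → H be the invertible continuous linear operator K(f) = 2λ₀ f + ∫ L''_{f_ν} f Φ dν. Then lim_{s→0} ‖ (f_{L,ν+sμ,λ₀} − f_{L,ν,λ₀})/s + K^{−1}( ∫ L'_{f_ν} Φ dμ ) ‖_H = 0; i.e., the map s ↦ f_{L,ν+sμ,λ₀}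 is differentiable at s = 0 with derivative −K^{−1}(∫L'_{f_ν}Φ dμ). -/
open MeasureTheory Filter Classical
open scoped ENNReal Topology RealInnerProductSpace

section helpers

set_option linter.unusedSectionVars false

variable {α : Type*} [TopologicalSpace α] [MeasurableSpace α] [BorelSpace α]
  [SecondCountableTopology α]
  {H : Type*} [NormedAddCommGroup H] [InnerProductSpace ℝ H] [CompleteSpace H]

/-- bound for the inner product -/
lemma svm_inner_bound {S : Set α} {u : α → H} {κ : ℝ} (hub : ∀ z ∈ S, ‖u z‖ ≤ κ)
    {z : α} (hz : z ∈ S) (f : H) : |⟪u z, f⟫| ≤ κ * ‖f‖ :=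
  (abs_real_inner_le_norm _ _).trans (by gcongr; exact hub z hz)

lemma svm_meas {S : Set α} (hS : MeasurableSet S) {E : Type*} [NormedAddCommGroup E]
    {F : α → E} (hF : ContinuousOn F S) {M : Measure α} (hM : ∀ᵐ z ∂M, z ∈ S) :
    AEStronglyMeasurable F M := by
  have := hF.aestronglyMeasurable (μ := M) hS
  rwa [Measure.restrict_eq_self_of_ae_mem hM] at this

lemma svm_cont {S : Set α} {u : α → H} (hu : ContinuousOn u S)
    {l : α → ℝ → ℝ}
    (hl : ContinuousOn (fun q : α × ℝ => l q.1 q.2) (S ×ˢ (Set.univ : Set ℝ))) (f : H) :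
    ContinuousOn (fun z => l z ⟪u z, f⟫) S := by
  have h1 : ContinuousOn (fun z => ((z, ⟪u z, f⟫) : α × ℝ)) S :=
    continuousOn_id.prodMk (hu.inner continuousOn_const)
  exact hl.comp h1 (fun z hz => ⟨hz, trivial⟩)

lemma svm_integrable {S : Set α} (hS : MeasurableSet S) {u : α → H} (hu : ContinuousOn u S)
    {κ : ℝ} (hκ : 0 ≤ κ) (hub : ∀ z ∈ S, ‖u z‖ ≤ κ) {l' : α → ℝ → ℝ}
    (hl' : ContinuousOn (fun q : α × ℝ => l' q.1 q.2) (S ×ˢ (Set.univ : Set ℝ)))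
    {M : Measure α} (hM : ∀ᵐ z ∂M, z ∈ S)
    (henv : ∀ a : ℝ, 0 < a → ∃ b' : α → ℝ, Integrable b' M ∧
      ∀ z ∈ S, ∀ t ∈ Set.Icc (-a) a, |l' z t| ≤ b' z) (f : H) :
    Integrable (fun z => l' z ⟪u z, f⟫ • u z) M := by
  obtain ⟨b', hb', hb⟩ := henv (κ * ‖f‖ + 1) (by positivity)
  refine Integrable.mono' (hb'.mul_const κ) (svm_meas hS ((svm_cont hu hl' f).smul hu) hM) ?_
  filter_upwards [hM] with z hz
  have h1 := abs_le.1 (svm_inner_bound hub hz f)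
  have h2 := hb z hz ⟪u z, f⟫ ⟨by linarith [h1.1], by linarith [h1.2]⟩
  rw [norm_smul, Real.norm_eq_abs]
  gcongr
  · exact (abs_nonneg _).trans h2
  · exact hub z hz

lemma svm_line_bound {S : Set α} {u : α → H} {κ : ℝ} (hκ : 0 ≤ κ)
    (hub : ∀ z ∈ S, ‖u z‖ ≤ κ)
    {z : α} (hz : z ∈ S) (f h : H) {t : ℝ} (ht : t ∈ Metric.ball (0 : ℝ) 1) :
    ⟪u z, f + t • h⟫ ∈ Set.Icc (-(κ * (‖f‖ + ‖h‖) + 1)) (κ * (‖f‖ + ‖h‖) + 1) := by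
  have h1 := svm_inner_bound hub hz (f + t • h)
  have ht' : |t| ≤ 1 := by simpa using (Metric.mem_ball.1 ht).le
  have h2 : ‖f + t • h‖ ≤ ‖f‖ + ‖h‖ := by
    refine (norm_add_le _ _).trans ?_
    rw [norm_smul, Real.norm_eq_abs]
    nlinarith [norm_nonneg h]
  have h3 : κ * ‖f + t • h‖ ≤ κ * (‖f‖ + ‖h‖) := by gcongr
  have h4 := abs_le.1 h1
  exact ⟨by linarith, by linarith⟩

lemma svm_line_deriv (w f h : H) (t : ℝ) :
    HasDerivAt (fun t : ℝ => ⟪w, f + t • h⟫) ⟪w, h⟫ t := by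
  have h0 : (fun t : ℝ => ⟪w, f + t • h⟫) = fun t : ℝ => ⟪w, f⟫ + t * ⟪w, h⟫ := by
    ext t; rw [inner_add_right, inner_smul_right]
  rw [h0]
  simpa using ((hasDerivAt_id t).mul_const ⟪w, h⟫).const_add ⟪w, f⟫

/-- first-order condition -/
lemma svm_first_order {S : Set α} (hS : MeasurableSet S) {u : α → H} (hu : ContinuousOn u S)
    {κ : ℝ} (hκ : 0 ≤ κ) (hub : ∀ z ∈ S, ‖u z‖ ≤ κ) {l l' : α → ℝ → ℝ}
    (hlm : Measurable (fun q : α × ℝ => l q.1 q.2))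
    (hd : ∀ z ∈ S, ∀ t, HasDerivAt (l z) (l' z t) t)
    (hl' : ContinuousOn (fun q : α × ℝ => l' q.1 q.2) (S ×ˢ (Set.univ : Set ℝ)))
    {M : Measure α} [IsFiniteMeasure M] (hM : ∀ᵐ z ∂M, z ∈ S)
    (henv : ∀ a : ℝ, 0 < a → ∃ b' : α → ℝ, Integrable b' M ∧
      ∀ z ∈ S, ∀ t ∈ Set.Icc (-a) a, |l' z t| ≤ b' z)
    {p : ℝ} (hp : 1 ≤ p) {b : α → ℝ} (hb : Integrable b M)
    (hN : ∀ z ∈ S, ∀ t : ℝ, |l z t| ≤ b z + |t| ^ p)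
    {lam : ℝ} {f : H}
    (hmin : ∀ g : H, ∫ z, l z ⟪u z, f⟫ ∂M + lam * ‖f‖ ^ 2 ≤
      ∫ z, l z ⟪u z, g⟫ ∂M + lam * ‖g‖ ^ 2) (v : H) :
    ⟪(2 * lam) • f + ∫ z, l' z ⟪u z, f⟫ • u z ∂M, v⟫ = 0 := by
  have hmeasl : ∀ g : H, AEStronglyMeasurable (fun z => l z ⟪u z, g⟫) M := by
    intro g
    have h1 : AEMeasurable (fun z => ((z, ⟪u z, g⟫) : α × ℝ)) M :=
      aemeasurable_id.prodMk
        (svm_meas hS (hu.inner continuousOn_const) hM).aemeasurable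
    exact (hlm.comp_aemeasurable h1).aestronglyMeasurable
  have hintl : Integrable (fun z => l z ⟪u z, f⟫) M := by
    refine Integrable.mono' (hb.add (integrable_const ((κ * ‖f‖) ^ p))) (hmeasl f) ?_
    filter_upwards [hM] with z hz
    refine (hN z hz _).trans ?_
    have := svm_inner_bound hub hz f
    simp only [Pi.add_apply]
    gcongr
  obtain ⟨b', hb', hbb⟩ := henv (κ * (‖f‖ + ‖v‖) + 1) (by positivity)
  have key := (hasDerivAt_integral_of_dominated_loc_of_deriv_le (𝕜 := ℝ) (μ := M)
    (F := fun t z => l z ⟪u z, f + t • v⟫) (x₀ := 0) (s := Metric.ball 0 1)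
    (F' := fun t z => l' z ⟪u z, f + t • v⟫ * ⟪u z, v⟫)
    (bound := fun z => b' z * (κ * ‖v‖))
    (Metric.ball_mem_nhds _ one_pos) (Eventually.of_forall fun t => hmeasl _)
    (by simpa using hintl)
    (svm_meas hS ((svm_cont hu hl' _).mul (hu.inner continuousOn_const)) hM)
    (by
      filter_upwards [hM] with z hz t ht
      have h2 := hbb z hz _ (svm_line_bound hκ hub hz f v ht)
      rw [Real.norm_eq_abs, abs_mul]
      gcongr
      · exact (abs_nonneg _).trans h2
      · exact svm_inner_bound hub hz v)
    (hb'.mul_const _)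
    (by
      filter_upwards [hM] with z hz t ht
      exact HasDerivAt.comp t (hd z hz _) (svm_line_deriv (u z) f v t))).2
  have hnorm : HasDerivAt (fun t : ℝ => lam * ‖f + t • v‖ ^ 2) (lam * (2 * ⟪f, v⟫)) 0 := by
    have h1 : HasDerivAt (fun t : ℝ => f + t • v) v 0 := by
      simpa using ((hasDerivAt_id (0:ℝ)).smul_const v).const_add f
    simpa using h1.norm_sq.const_mul lam
  have hsum := key.add hnorm
  have hloc : IsLocalMin ((fun t : ℝ => ∫ z, l z ⟪u z, f + t • v⟫ ∂M) +
      (fun t : ℝ => lam * ‖f + t • v‖ ^ 2)) 0 := by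
    refine Eventually.of_forall fun t => ?_
    simpa using hmin (f + t • v)
  have h0 := hloc.hasDerivAt_eq_zero hsum
  have hinteg := svm_integrable hS hu hκ hub hl' hM henv f
  rw [inner_add_left, real_inner_smul_left, real_inner_comm v (∫ z, _ ∂M), ← integral_inner hinteg]
  have h3 : (fun z => ⟪v, l' z ⟪u z, f⟫ • u z⟫) = fun z => l' z ⟪u z, f + (0:ℝ) • v⟫ * ⟪u z, v⟫ := by
    ext z; rw [real_inner_smul_right, real_inner_comm v]; simp
  rw [h3]
  linarith

/-- strong monotonicity estimate -/
lemma svm_estimate {S : Set α} (hS : MeasurableSet S) {u : α → H} (hu : ContinuousOn u S)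
    {κ : ℝ} (hκ : 0 ≤ κ) (hub : ∀ z ∈ S, ‖u z‖ ≤ κ) {l' : α → ℝ → ℝ}
    (hmono : ∀ z ∈ S, Monotone (l' z))
    (hl' : ContinuousOn (fun q : α × ℝ => l' q.1 q.2) (S ×ˢ (Set.univ : Set ℝ)))
    {M : Measure α} (hM : ∀ᵐ z ∂M, z ∈ S)
    (henv : ∀ a : ℝ, 0 < a → ∃ b' : α → ℝ, Integrable b' M ∧
      ∀ z ∈ S, ∀ t ∈ Set.Icc (-a) a, |l' z t| ≤ b' z)
    {lam : ℝ} {f : H}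
    (hfo : ∀ v : H, ⟪(2 * lam) • f + ∫ z, l' z ⟪u z, f⟫ • u z ∂M, v⟫ = 0) (g : H) :
    2 * lam * ‖f - g‖ ≤ ‖(2 * lam) • g + ∫ z, l' z ⟪u z, g⟫ • u z ∂M‖ := by
  have hi := svm_integrable hS hu hκ hub hl' hM henv
  have h1 : 0 ≤ ⟪∫ z, l' z ⟪u z, f⟫ • u z ∂M - ∫ z, l' z ⟪u z, g⟫ • u z ∂M, f - g⟫ := by
    rw [← integral_sub (hi f) (hi g), real_inner_comm]
    have e := integral_inner (𝕜 := ℝ) ((hi f).sub (hi g)) (f - g)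
    simp only [Pi.sub_apply] at e
    rw [← e]
    apply integral_nonneg_of_ae
    filter_upwards [hM] with z hz
    simp only [Pi.zero_apply]
    rw [← sub_smul, real_inner_smul_right, real_inner_comm (u z) (f - g), inner_sub_right]
    rcases le_total ⟪u z, f⟫ ⟪u z, g⟫ with h | h
    · have := hmono z hz h
      exact mul_nonneg_of_nonpos_of_nonpos (by linarith) (by linarith)
    · have := hmono z hz h
      exact mul_nonneg (by linarith) (by linarith)
  have h2 := hfo (f - g)
  set A := ∫ z, l' z ⟪u z, f⟫ • u z ∂M
  set B := ∫ z, l' z ⟪u z, g⟫ • u z ∂M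
  have h3 : 2 * lam * ‖f - g‖ ^ 2 ≤ - ⟪(2 * lam) • g + B, f - g⟫ := by
    have e : 2 * lam * ‖f - g‖ ^ 2 = ⟪(2 * lam) • (f - g), f - g⟫ := by
      rw [real_inner_smul_left, real_inner_self_eq_norm_sq]
    rw [e]
    have e2 : ⟪(2 * lam) • (f - g), f - g⟫ + ⟪A - B, f - g⟫
      = ⟪(2 * lam) • f + A, f - g⟫ - ⟪(2 * lam) • g + B, f - g⟫ := by
      rw [← inner_add_left, ← inner_sub_left]
      congr 1
      module
    linarith
  have h4 := (abs_le.1 (abs_real_inner_le_norm ((2 * lam) • g + B) (f - g))).1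
  rcases (norm_nonneg (f - g)).eq_or_lt with h | h
  · rw [← h]; simp
  · refine le_of_mul_le_mul_right ?_ h
    nlinarith

/-- differentiability of the gradient along the line -/
lemma svm_deriv {S : Set α} (hS : MeasurableSet S) {u : α → H} (hu : ContinuousOn u S)
    {κ : ℝ} (hκ : 0 ≤ κ) (hub : ∀ z ∈ S, ‖u z‖ ≤ κ) {l' l'' : α → ℝ → ℝ}
    (hd : ∀ z ∈ S, ∀ t, HasDerivAt (l' z) (l'' z t) t)
    (hl' : ContinuousOn (fun q : α × ℝ => l' q.1 q.2) (S ×ˢ (Set.univ : Set ℝ)))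
    (hl'' : ContinuousOn (fun q : α × ℝ => l'' q.1 q.2) (S ×ˢ (Set.univ : Set ℝ)))
    {M : Measure α} [IsFiniteMeasure M] (hM : ∀ᵐ z ∂M, z ∈ S)
    (henv : ∀ a : ℝ, 0 < a → ∃ b' : α → ℝ, Integrable b' M ∧
      ∀ z ∈ S, ∀ t ∈ Set.Icc (-a) a, |l' z t| ≤ b' z)
    (henv2 : ∀ a : ℝ, 0 < a → ∃ b'' : ℝ, 0 ≤ b'' ∧
      ∀ z ∈ S, ∀ t ∈ Set.Icc (-a) a, |l'' z t| ≤ b'') (f h : H) :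
    HasDerivAt (fun s : ℝ => ∫ z, l' z ⟪u z, f + s • h⟫ • u z ∂M)
      (∫ z, (l'' z ⟪u z, f⟫ * ⟪u z, h⟫) • u z ∂M) 0 := by
  obtain ⟨b'', hb0, hbb⟩ := henv2 (κ * (‖f‖ + ‖h‖) + 1) (by positivity)
  have key := (hasDerivAt_integral_of_dominated_loc_of_deriv_le (𝕜 := ℝ) (μ := M)
    (F := fun t z => l' z ⟪u z, f + t • h⟫ • u z) (x₀ := 0) (s := Metric.ball 0 1)
    (F' := fun t z => (l'' z ⟪u z, f + t • h⟫ * ⟪u z, h⟫) • u z)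
    (bound := fun z => (b'' * (κ * ‖h‖)) * κ)
    (Metric.ball_mem_nhds _ one_pos)
    (Eventually.of_forall fun t => svm_meas hS ((svm_cont hu hl' _).smul hu) hM)
    (svm_integrable hS hu hκ hub hl' hM henv _)
    (svm_meas hS (((svm_cont hu hl'' _).mul (hu.inner continuousOn_const)).smul hu) hM)
    (by
      filter_upwards [hM] with z hz t ht
      have h2 := hbb z hz _ (svm_line_bound hκ hub hz f h ht)
      rw [norm_smul, Real.norm_eq_abs, abs_mul]
      gcongr
      · exact svm_inner_bound hub hz h
      · exact hub z hz)
    (integrable_const _)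
    (by
      filter_upwards [hM] with z hz t ht
      exact (HasDerivAt.comp t (hd z hz _) (svm_line_deriv (u z) f h t)).smul_const (u z))).2
  simpa using key

/-- continuity of the gradient along the line -/
lemma svm_continuous {S : Set α} (hS : MeasurableSet S) {u : α → H} (hu : ContinuousOn u S)
    {κ : ℝ} (hκ : 0 ≤ κ) (hub : ∀ z ∈ S, ‖u z‖ ≤ κ) {l' l'' : α → ℝ → ℝ}
    (hd : ∀ z ∈ S, ∀ t, HasDerivAt (l' z) (l'' z t) t)
    (hl' : ContinuousOn (fun q : α × ℝ => l' q.1 q.2) (S ×ˢ (Set.univ : Set ℝ)))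
    {M : Measure α} (hM : ∀ᵐ z ∂M, z ∈ S)
    (henv : ∀ a : ℝ, 0 < a → ∃ b' : α → ℝ, Integrable b' M ∧
      ∀ z ∈ S, ∀ t ∈ Set.Icc (-a) a, |l' z t| ≤ b' z) (f h : H) :
    ContinuousAt (fun s : ℝ => ∫ z, l' z ⟪u z, f + s • h⟫ • u z ∂M) 0 := by
  obtain ⟨b', hb', hbb⟩ := henv (κ * (‖f‖ + ‖h‖) + 1) (by positivity)
  refine continuousAt_of_dominated (bound := fun z => b' z * κ)
    (Eventually.of_forall fun t => svm_meas hS ((svm_cont hu hl' _).smul hu) hM) ?_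
    (hb'.mul_const _) ?_
  · filter_upwards [Metric.ball_mem_nhds (0:ℝ) one_pos] with t ht
    filter_upwards [hM] with z hz
    have h2 := hbb z hz _ (svm_line_bound hκ hub hz f h ht)
    rw [norm_smul, Real.norm_eq_abs]
    gcongr
    · exact (abs_nonneg _).trans h2
    · exact hub z hz
  · filter_upwards [hM] with z hz
    exact ((HasDerivAt.comp (0:ℝ) (hd z hz _)
      (svm_line_deriv (u z) f h 0)).smul_const (u z)).continuousAt

end helpers

section measures

variable {α : Type*} [MeasurableSpace α]

lemma svm_signed_pos (m : SignedMeasure α) (hm : 0 ≤ m) :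
    ∃ M : Measure α, ∃ _ : IsFiniteMeasure M,
      m.toJordanDecomposition.posPart = M ∧ m.toJordanDecomposition.negPart = 0 ∧
      ∀ A, MeasurableSet A → M.real A = m A := by
  have h0 : 0 ≤[Set.univ] m := by
    rw [VectorMeasure.restrict_univ, VectorMeasure.restrict_univ]; exact hm
  have h1 := SignedMeasure.toMeasureOfZeroLE_toSignedMeasure m h0
  set M := m.toMeasureOfZeroLE Set.univ MeasurableSet.univ h0
  let j : JordanDecomposition α :=
    { posPart := M, negPart := 0, mutuallySingular := Measure.MutuallySingular.zero_right }
  have hj : j.toSignedMeasure = m := by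
    simp only [JordanDecomposition.toSignedMeasure, j, Measure.toSignedMeasure_zero, sub_zero]
    exact h1
  have hj2 : m.toJordanDecomposition = j := by
    rw [← hj]; exact JordanDecomposition.toJordanDecomposition_toSignedMeasure j
  refine ⟨M, inferInstance, by rw [hj2], by rw [hj2], fun A hA => ?_⟩
  rw [← h1, Measure.toSignedMeasure_apply_measurable hA]

lemma svm_measure_eq (ν : Measure α) [IsFiniteMeasure ν] (μ : SignedMeasure α) (s : ℝ)
    (M : Measure α) [IsFiniteMeasure M]
    (h : ∀ A, MeasurableSet A → M.real A = (ν.toSignedMeasure + s • μ) A) :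
    M + (Real.toNNReal s • μ.toJordanDecomposition.negPart
        + Real.toNNReal (-s) • μ.toJordanDecomposition.posPart)
      = ν + (Real.toNNReal s • μ.toJordanDecomposition.posPart
        + Real.toNNReal (-s) • μ.toJordanDecomposition.negPart) := by
  ext A hA
  have h1 := h A hA
  rw [add_apply, smul_apply,
    Measure.toSignedMeasure_apply_measurable hA,
    μ.apply_eq_posPart_real_sub_negPart_real hA] at h1
  rw [← ENNReal.toReal_eq_toReal_iff' (measure_ne_top _ _) (measure_ne_top _ _)]
  change Measure.real _ A = Measure.real _ A
  rw [measureReal_add_apply, measureReal_add_apply, measureReal_add_apply, measureReal_add_apply]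
  simp only [measureReal_nnreal_smul_apply, Real.coe_toNNReal', h1]
  have : s = max s 0 - max (-s) 0 := by
    rcases le_total 0 s with h | h
    · rw [max_eq_left h, max_eq_right (by linarith)]; ring
    · rw [max_eq_right h, max_eq_left (by linarith)]; ring
  conv_lhs => rw [smul_eq_mul]; enter [1, 2, 1]; rw [this]
  ring

lemma svm_measure_integral {E : Type*} [NormedAddCommGroup E] [NormedSpace ℝ E]
    {ν P N M : Measure α} {s : ℝ}
    (h : M + (Real.toNNReal s • N + Real.toNNReal (-s) • P)
      = ν + (Real.toNNReal s • P + Real.toNNReal (-s) • N)) {f : α → E}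
    (hν : Integrable f ν) (hP : Integrable f P) (hN : Integrable f N) :
    Integrable f M ∧ ∫ z, f z ∂M = ∫ z, f z ∂ν + s • (∫ z, f z ∂P - ∫ z, f z ∂N) := by
  have i1 : Integrable f (Real.toNNReal s • P + Real.toNNReal (-s) • N) :=
    (hP.smul_measure_nnreal).add_measure hN.smul_measure_nnreal
  have i2 : Integrable f (Real.toNNReal s • N + Real.toNNReal (-s) • P) :=
    (hN.smul_measure_nnreal).add_measure hP.smul_measure_nnreal
  have i3 : Integrable f M := by
    have := hν.add_measure i1
    rw [← h] at this
    exact this.left_of_add_measure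
  refine ⟨i3, ?_⟩
  have e : ∫ z, f z ∂(M + (Real.toNNReal s • N + Real.toNNReal (-s) • P))
      = ∫ z, f z ∂(ν + (Real.toNNReal s • P + Real.toNNReal (-s) • N)) := by rw [h]
  rw [integral_add_measure i3 i2, integral_add_measure hν i1,
    integral_add_measure hN.smul_measure_nnreal hP.smul_measure_nnreal,
    integral_add_measure hP.smul_measure_nnreal hN.smul_measure_nnreal] at e
  simp only [integral_smul_nnreal_measure, NNReal.smul_def, Real.coe_toNNReal'] at e
  have hs : s = max s 0 - max (-s) 0 := by
    rcases le_total 0 s with h | h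
    · rw [max_eq_left h, max_eq_right (by linarith)]; ring
    · rw [max_eq_right h, max_eq_left (by linarith)]; ring
  rw [hs, eq_sub_of_add_eq e]
  rw [← hs]
  generalize max s 0 = c at *
  generalize max (-s) 0 = c' at *
  subst hs
  module

lemma svm_ae_mem (μ : SignedMeasure α) {S : Set α} (hS : MeasurableSet S)
    (h : ∀ A : Set α, MeasurableSet A → A ⊆ Sᶜ → μ A = 0) :
    (∀ᵐ z ∂μ.toJordanDecomposition.posPart, z ∈ S) ∧
      (∀ᵐ z ∂μ.toJordanDecomposition.negPart, z ∈ S) := by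
  obtain ⟨i, hi₁, hi₂, hi₃, hpos, hneg⟩ := μ.toJordanDecomposition_spec
  rw [hpos, hneg]
  constructor
  · rw [ae_iff]
    change (μ.toMeasureOfZeroLE i hi₁ hi₂) Sᶜ = 0
    rw [SignedMeasure.toMeasureOfZeroLE_apply _ _ _ hS.compl]
    simp [h _ (hi₁.inter hS.compl) Set.inter_subset_right]
  · rw [ae_iff]
    change (μ.toMeasureOfLEZero iᶜ hi₁.compl hi₃) Sᶜ = 0
    rw [SignedMeasure.toMeasureOfLEZero_apply _ _ _ hS.compl]
    simp [h _ (hi₁.compl.inter hS.compl) Set.inter_subset_right]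

end measures

/-- **Gâteaux differentiability of the SVM-functional** (Proposition 1 of the paper).
If `ν + sμ` is a nonzero finite positive measure for all `s ∈ (-ρ,ρ)`, then
`s ↦ f_{L,ν+sμ,λ₀}` is differentiable at `s = 0` with derivative
`-K⁻¹(∫ L'_{f_ν} Φ dμ)`, where `K(f) = 2λ₀ f + ∫ L''_{f_ν} f Φ dν`. -/
theorem svm_gateaux_differentiable
    (d : ℕ) (X : Set (EuclideanSpace ℝ (Fin d))) [CompactSpace X]
    (Y : Set ℝ) (hY : IsClosed Y)
    -- the separable RKHS `H` of a continuous bounded kernel, via its feature map `Φ`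
    (H : Type) [NormedAddCommGroup H] [InnerProductSpace ℝ H] [CompleteSpace H]
    [TopologicalSpace.SeparableSpace H]
    (Φ : EuclideanSpace ℝ (Fin d) → H)
    (hΦcont : ContinuousOn Φ X)
    (κ : ℝ) (hΦbdd : ∀ x ∈ X, ‖Φ x‖ ≤ κ)
    (lam0 : ℝ) (hlam0 : 0 < lam0)
    -- the loss function, convex in its third argument, and its partial derivatives
    (L L' L'' : EuclideanSpace ℝ (Fin d) → ℝ → ℝ → ℝ)
    (hLmeas : Measurable (fun q : (EuclideanSpace ℝ (Fin d) × ℝ) × ℝ => L q.1.1 q.1.2 q.2))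
    (hLnonneg : ∀ x ∈ X, ∀ y ∈ Y, ∀ t : ℝ, 0 ≤ L x y t)
    (hLconvex : ∀ x ∈ X, ∀ y ∈ Y, ConvexOn ℝ Set.univ (L x y))
    (hL' : ∀ x ∈ X, ∀ y ∈ Y, ∀ t : ℝ, HasDerivAt (L x y) (L' x y t) t)
    (hL'' : ∀ x ∈ X, ∀ y ∈ Y, ∀ t : ℝ, HasDerivAt (L' x y) (L'' x y t) t)
    (hL'cont : ContinuousOn (fun q : (EuclideanSpace ℝ (Fin d) × ℝ) × ℝ => L' q.1.1 q.1.2 q.2)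
      ((X ×ˢ Y) ×ˢ (Set.univ : Set ℝ)))
    (hL''cont : ContinuousOn (fun q : (EuclideanSpace ℝ (Fin d) × ℝ) × ℝ => L'' q.1.1 q.1.2 q.2)
      ((X ×ˢ Y) ×ˢ (Set.univ : Set ℝ)))
    -- the nonzero finite measure `ν` on `X × Y` and its integrability properties
    (ν : Measure (EuclideanSpace ℝ (Fin d) × ℝ)) [IsFiniteMeasure ν]
    (hνne : ν ≠ 0)
    (hνsupp : ν ((X ×ˢ Y)ᶜ) = 0)
    -- the finite signed measure `μ` on `X × Y` and its integrability properties
    (μ : SignedMeasure (EuclideanSpace ℝ (Fin d) × ℝ))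
    (hμsupp : ∀ A : Set (EuclideanSpace ℝ (Fin d) × ℝ),
      MeasurableSet A → A ⊆ (X ×ˢ Y)ᶜ → μ A = 0)
    (p : ℝ) (hp : 1 ≤ p)
    (b : EuclideanSpace ℝ (Fin d) × ℝ → ℝ)
    (hbν : Integrable b ν) (hbμ : Integrable b μ.totalVariation)
    (hNemitski : ∀ x ∈ X, ∀ y ∈ Y, ∀ t : ℝ, |L x y t| ≤ b (x, y) + |t| ^ p)
    (henv : ∀ a : ℝ, 0 < a → ∃ b' : EuclideanSpace ℝ (Fin d) × ℝ → ℝ, ∃ b'' : ℝ,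
      Integrable b' ν ∧ Integrable b' μ.totalVariation ∧ 0 ≤ b'' ∧
      ∀ x ∈ X, ∀ y ∈ Y, ∀ t ∈ Set.Icc (-a) a, |L' x y t| ≤ b' (x, y) ∧ |L'' x y t| ≤ b'')
    -- `ν + sμ` is a nonzero positive measure for every `s ∈ (-ρ,ρ)`
    (ρ : ℝ) (hρ : 0 < ρ)
    (hpos : ∀ s ∈ Set.Ioo (-ρ) ρ,
      0 ≤ ν.toSignedMeasure + s • μ ∧ ν.toSignedMeasure + s • μ ≠ 0)
    -- `fs s` is the SVM `f_{L,ν+sμ,λ₀}` for `s ∈ (-ρ,ρ)`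
    (fs : ℝ → H)
    (hfs : ∀ s ∈ Set.Ioo (-ρ) ρ, ∀ g : H,
      sintegral (ν.toSignedMeasure + s • μ)
          (fun z : EuclideanSpace ℝ (Fin d) × ℝ => L z.1 z.2 ⟪Φ z.1, fs s⟫)
        + lam0 * ‖fs s‖ ^ 2 ≤
      sintegral (ν.toSignedMeasure + s • μ)
          (fun z : EuclideanSpace ℝ (Fin d) × ℝ => L z.1 z.2 ⟪Φ z.1, g⟫)
        + lam0 * ‖g‖ ^ 2)
    -- the invertible continuous linear operator `K(f) = 2λ₀ f + ∫ L''_{f_ν} f Φ dν`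
    (K : H ≃L[ℝ] H)
    (hK : ∀ f : H,
      K f = (2 * lam0) • f +
        ∫ z, (L'' z.1 z.2 ⟪Φ z.1, fs 0⟫ * ⟪Φ z.1, f⟫) • Φ z.1 ∂ν) :
    -- conclusion: `s ↦ f_{L,ν+sμ,λ₀}` is differentiable at `0` with derivative
    -- `-K⁻¹(∫ L'_{f_ν} Φ dμ)`
    Filter.Tendsto
      (fun s : ℝ =>
        ‖s⁻¹ • (fs s - fs 0) +
          K.symm (sintegral μ (fun z : EuclideanSpace ℝ (Fin d) × ℝ =>
            L' z.1 z.2 ⟪Φ z.1, fs 0⟫ • Φ z.1))‖)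
      (nhdsWithin (0 : ℝ) {0}ᶜ) (nhds (0 : ℝ)) := by
  have hXm : MeasurableSet X := (isCompact_iff_compactSpace.2 inferInstance).measurableSet
  set S : Set (EuclideanSpace ℝ (Fin d) × ℝ) := X ×ˢ Y with hSdef
  have hS : MeasurableSet S := hXm.prod hY.measurableSet
  set u : EuclideanSpace ℝ (Fin d) × ℝ → H := fun z => Φ z.1 with hudef
  have hu : ContinuousOn u S := hΦcont.comp continuousOn_fst (fun z hz => hz.1)
  obtain ⟨κ', hκ, hub⟩ : ∃ κ' : ℝ, 0 ≤ κ' ∧ ∀ z ∈ S, ‖u z‖ ≤ κ' :=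
    ⟨max κ 0, le_max_right _ _, fun z hz => (hΦbdd z.1 hz.1).trans (le_max_left _ _)⟩
  set l : EuclideanSpace ℝ (Fin d) × ℝ → ℝ → ℝ := fun z => L z.1 z.2 with hl
  set l' : EuclideanSpace ℝ (Fin d) × ℝ → ℝ → ℝ := fun z => L' z.1 z.2 with hl'
  set l'' : EuclideanSpace ℝ (Fin d) × ℝ → ℝ → ℝ := fun z => L'' z.1 z.2 with hl''
  set P := μ.toJordanDecomposition.posPart with hP
  set N := μ.toJordanDecomposition.negPart with hN
  have hd1 : ∀ z ∈ S, ∀ t, HasDerivAt (l z) (l' z t) t := fun z hz t => hL' z.1 hz.1 z.2 hz.2 t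
  have hd2 : ∀ z ∈ S, ∀ t, HasDerivAt (l' z) (l'' z t) t := fun z hz t => hL'' z.1 hz.1 z.2 hz.2 t
  have hmono : ∀ z ∈ S, Monotone (l' z) := by
    intro z hz
    have hder : l' z = deriv (l z) := by
      ext t; exact (hd1 z hz t).deriv.symm
    rw [hder, ← monotoneOn_univ]
    exact (hLconvex z.1 hz.1 z.2 hz.2).monotoneOn_deriv
      (fun t _ => (hd1 z hz t).differentiableAt)
  have haeν : ∀ᵐ z ∂ν, z ∈ S := hνsupp
  obtain ⟨haeP, haeN⟩ := svm_ae_mem μ hS hμsupp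
  have tvP : ∀ {f : EuclideanSpace ℝ (Fin d) × ℝ → ℝ}, Integrable f μ.totalVariation →
      Integrable f P := fun h => Integrable.left_of_add_measure h
  have tvN : ∀ {f : EuclideanSpace ℝ (Fin d) × ℝ → ℝ}, Integrable f μ.totalVariation →
      Integrable f N := fun h => Integrable.right_of_add_measure h
  have envν : ∀ a : ℝ, 0 < a → ∃ b' : EuclideanSpace ℝ (Fin d) × ℝ → ℝ, Integrable b' ν ∧
      ∀ z ∈ S, ∀ t ∈ Set.Icc (-a) a, |l' z t| ≤ b' z := by
    intro a ha
    obtain ⟨b', b'', h1, h2, h3, h4⟩ := henv a ha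
    exact ⟨b', h1, fun z hz t ht => (h4 z.1 hz.1 z.2 hz.2 t ht).1⟩
  have envP : ∀ a : ℝ, 0 < a → ∃ b' : EuclideanSpace ℝ (Fin d) × ℝ → ℝ, Integrable b' P ∧
      ∀ z ∈ S, ∀ t ∈ Set.Icc (-a) a, |l' z t| ≤ b' z := by
    intro a ha
    obtain ⟨b', b'', h1, h2, h3, h4⟩ := henv a ha
    exact ⟨b', tvP h2, fun z hz t ht => (h4 z.1 hz.1 z.2 hz.2 t ht).1⟩
  have envN : ∀ a : ℝ, 0 < a → ∃ b' : EuclideanSpace ℝ (Fin d) × ℝ → ℝ, Integrable b' N ∧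
      ∀ z ∈ S, ∀ t ∈ Set.Icc (-a) a, |l' z t| ≤ b' z := by
    intro a ha
    obtain ⟨b', b'', h1, h2, h3, h4⟩ := henv a ha
    exact ⟨b', tvN h2, fun z hz t ht => (h4 z.1 hz.1 z.2 hz.2 t ht).1⟩
  have env2 : ∀ a : ℝ, 0 < a → ∃ b'' : ℝ, 0 ≤ b'' ∧
      ∀ z ∈ S, ∀ t ∈ Set.Icc (-a) a, |l'' z t| ≤ b'' := by
    intro a ha
    obtain ⟨b', b'', h1, h2, h3, h4⟩ := henv a ha
    exact ⟨b'', h3, fun z hz t ht => (h4 z.1 hz.1 z.2 hz.2 t ht).2⟩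
  have iν := svm_integrable hS hu hκ hub hL'cont haeν envν
  have iP := svm_integrable hS hu hκ hub hL'cont haeP envP
  have iN := svm_integrable hS hu hκ hub hL'cont haeN envN
  -- the gradient of the regularized risk, evaluated at `g`
  let G : ℝ → H → H := fun s g => (2 * lam0) • g + (∫ z, l' z ⟪u z, g⟫ • u z ∂ν
    + s • (∫ z, l' z ⟪u z, g⟫ • u z ∂P - ∫ z, l' z ⟪u z, g⟫ • u z ∂N))
  have main : ∀ s ∈ Set.Ioo (-ρ) ρ, (∀ v, ⟪G s (fs s), v⟫ = 0) ∧
      ∀ g, 2 * lam0 * ‖fs s - g‖ ≤ ‖G s g‖ := by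
    intro s hs
    obtain ⟨M, hMfin, hMp, hMn, hMr⟩ := svm_signed_pos _ (hpos s hs).1
    have hMeq := svm_measure_eq ν μ s M hMr
    have haeM : ∀ᵐ z ∂M, z ∈ S := by
      have h1 : (M + (Real.toNNReal s • N + Real.toNNReal (-s) • P)) Sᶜ = 0 := by
        have e1 : ν Sᶜ = 0 := haeν
        have e2 : P Sᶜ = 0 := haeP
        have e3 : N Sᶜ = 0 := haeN
        rw [hMeq]
        simp [e1, e2, e3, ← hP, ← hN]
      rw [Measure.add_apply] at h1
      exact (add_eq_zero.1 h1).1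
    have envM : ∀ a : ℝ, 0 < a → ∃ b' : EuclideanSpace ℝ (Fin d) × ℝ → ℝ, Integrable b' M ∧
        ∀ z ∈ S, ∀ t ∈ Set.Icc (-a) a, |l' z t| ≤ b' z := by
      intro a ha
      obtain ⟨b', b'', h1, h2, h3, h4⟩ := henv a ha
      exact ⟨b', (svm_measure_integral hMeq h1 (tvP h2) (tvN h2)).1,
        fun z hz t ht => (h4 z.1 hz.1 z.2 hz.2 t ht).1⟩
    have hmin : ∀ g : H, ∫ z, l z ⟪u z, fs s⟫ ∂M + lam0 * ‖fs s‖ ^ 2 ≤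
        ∫ z, l z ⟪u z, g⟫ ∂M + lam0 * ‖g‖ ^ 2 := by
      intro g
      have := hfs s hs g
      simpa only [sintegral, hMp, hMn, integral_zero_measure, sub_zero] using this
    have hG : ∀ g, G s g = (2 * lam0) • g + ∫ z, l' z ⟪u z, g⟫ • u z ∂M := by
      intro g
      rw [(svm_measure_integral hMeq (iν g) (iP g) (iN g)).2]
    have hfo := svm_first_order hS hu hκ hub hLmeas hd1 hL'cont haeM envM hp
      (svm_measure_integral hMeq hbν (tvP hbμ) (tvN hbμ)).1
      (fun z hz t => hNemitski z.1 hz.1 z.2 hz.2 t) hmin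
    refine ⟨fun v => by rw [hG]; exact hfo v, fun g => ?_⟩
    rw [hG]
    exact svm_estimate hS hu hκ hub hmono hL'cont haeM envM hfo g
  have h0mem : (0 : ℝ) ∈ Set.Ioo (-ρ) ρ := ⟨by linarith, hρ⟩
  have hG0 : G 0 (fs 0) = 0 := by
    have := (main 0 h0mem).1 (G 0 (fs 0))
    exact inner_self_eq_zero.1 this
  set D := sintegral μ (fun z : EuclideanSpace ℝ (Fin d) × ℝ =>
            L' z.1 z.2 ⟪Φ z.1, fs 0⟫ • Φ z.1) with hD
  set h : H := -K.symm D with hh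
  have hderν := svm_deriv hS hu hκ hub hd2 hL'cont hL''cont haeν envν env2 (fs 0) h
  have hcP := svm_continuous hS hu hκ hub hd2 hL'cont haeP envP (fs 0) h
  have hcN := svm_continuous hS hu hκ hub hd2 hL'cont haeN envN (fs 0) h
  have hKh : (2 * lam0) • h + ∫ z, (l'' z ⟪u z, fs 0⟫ * ⟪u z, h⟫) • u z ∂ν = -D := by
    rw [← hK h, hh]; simp
  have hslope := hderν.tendsto_slope_zero
  have hc : Tendsto (fun s : ℝ => ∫ z, l' z ⟪u z, fs 0 + s • h⟫ • u z ∂P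
      - ∫ z, l' z ⟪u z, fs 0 + s • h⟫ • u z ∂N) (𝓝[≠] 0) (𝓝 D) := by
    have := ((hcP.sub hcN).tendsto).mono_left (nhdsWithin_le_nhds (s := {0}ᶜ))
    simp only [Pi.sub_apply, zero_smul, add_zero] at this
    exact this
  have hlim : Tendsto (fun s : ℝ => s⁻¹ • G s (fs 0 + s • h)) (𝓝[≠] 0) (𝓝 0) := by
    have h1 := ((tendsto_const_nhds (x := (2 * lam0) • h)).add hslope).add hc
    rw [hKh, neg_add_cancel] at h1
    refine h1.congr' ?_
    filter_upwards [self_mem_nhdsWithin] with s hs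
    have hs' : s ≠ 0 := hs
    have e0 : (2 * lam0) • fs 0 + ∫ z, l' z ⟪u z, fs 0⟫ • u z ∂ν = 0 := by
      simpa [G] using hG0
    have e1 : ∫ z, l' z ⟪u z, fs 0⟫ • u z ∂ν = -((2 * lam0) • fs 0) := by
      rw [eq_neg_iff_add_eq_zero, add_comm]; exact e0
    simp only [zero_add, zero_smul, add_zero, G]
    rw [e1]
    generalize (∫ z, l' z ⟪u z, fs 0 + s • h⟫ • u z ∂ν) = A
    generalize (∫ z, l' z ⟪u z, fs 0 + s • h⟫ • u z ∂P) = B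
    generalize (∫ z, l' z ⟪u z, fs 0 + s • h⟫ • u z ∂N) = C
    match_scalars <;> field_simp
  have hlim2 : Tendsto (fun s : ℝ => (2 * lam0)⁻¹ * ‖s⁻¹ • G s (fs 0 + s • h)‖)
      (𝓝[≠] 0) (𝓝 0) := by
    simpa using hlim.norm.const_mul (2 * lam0)⁻¹
  refine squeeze_zero' (Eventually.of_forall fun s => norm_nonneg _) ?_ hlim2
  have hnear : ∀ᶠ s : ℝ in 𝓝[≠] 0, s ∈ Set.Ioo (-ρ) ρ :=
    nhdsWithin_le_nhds (Ioo_mem_nhds h0mem.1 h0mem.2)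
  filter_upwards [self_mem_nhdsWithin, hnear] with s hs0 hs
  have hs' : s ≠ 0 := hs0
  have h1 := (main s hs).2 (fs 0 + s • h)
  have h2 : s⁻¹ • (fs s - fs 0) + K.symm D = s⁻¹ • (fs s - (fs 0 + s • h)) := by
    have : K.symm D = -h := by rw [hh, neg_neg]
    rw [this]
    match_scalars <;> field_simp
  rw [h2, norm_smul, norm_smul, inv_mul_eq_div, le_div_iff₀ (by positivity)]
  have := mul_le_mul_of_nonneg_left h1 (norm_nonneg s⁻¹)
  linarith
end

section
/- Let T be any set, ℓ∞(T) the Banach space of bounded real-valued functions on T with the supremum norm, (Ω,𝒜,Q) a probability space, and 𝔾: Ω → ℓ∞(T) a tight Borel-measurable Gaussian process (i.e. h*(𝔾) is a real Gaussian random variable for every continuous linear functional h* on ℓ∞(T), and for every ε > 0 there is a compact set K ⊆ ℓ∞(T) with Q(𝔾 ∈ K) ≥ 1 − ε) such that ∫ 𝔾(ω)(t) Q(dω) = 0 for every t ∈ T. Then the Bochner integral ∫ 𝔾 dQ exists and equals 0, and moreover ∫ A(𝔾) dQ = 0 for every Banach space E and every continuous linear operator A: ℓ∞(T) → E. -/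
open MeasureTheory ProbabilityTheory Filter
open scoped ENNReal NNReal Topology

theorem integrable_of_tight_gaussian {B : Type*} [NormedAddCommGroup B] [NormedSpace ℝ B]
    [CompleteSpace B] {Ω : Type*} [MeasurableSpace Ω] (Q : Measure Ω) [IsProbabilityMeasure Q]
    (𝔾 : Ω → B)
    (hmeas : ∀ s : Set B, IsOpen s → MeasurableSet (𝔾 ⁻¹' s))
    (htight : ∀ ε : ℝ, 0 < ε → ∃ K : Set B,
      IsCompact K ∧ 1 - ENNReal.ofReal ε ≤ Q (𝔾 ⁻¹' K))
    (hgauss : ∀ hstar : B →L[ℝ] ℝ,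
      ∃ (m : ℝ) (v : ℝ≥0), Measure.map (fun ω => hstar (𝔾 ω)) Q = gaussianReal m v) :
    Integrable 𝔾 Q := by
  classical
  let : MeasurableSpace B := borel B
  have : BorelSpace B := ⟨rfl⟩
  have hGm : Measurable 𝔾 := measurable_of_isOpen hmeas
  choose K hKc hK using fun n : ℕ => htight (1 / ((n : ℝ) + 1)) (by positivity)
  let S : Submodule ℝ B := (Submodule.span ℝ (⋃ n, K n)).topologicalClosure
  have hSc : IsClosed (S : Set B) := Submodule.isClosed_topologicalClosure _
  have hSsep : TopologicalSpace.IsSeparable (S : Set B) := by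
    have := (TopologicalSpace.IsSeparable.iUnion
      (fun n => (hKc n).isSeparable)).span (R := ℝ) |>.closure
    simpa [S, Submodule.topologicalClosure_coe] using this
  have : TopologicalSpace.SeparableSpace S := hSsep.separableSpace
  have : SecondCountableTopology S := UniformSpace.secondCountable_of_separable S
  have : CompleteSpace S := hSc.completeSpace_coe
  have hKS : ∀ n, K n ⊆ S := fun n x hx =>
    Submodule.le_topologicalClosure _ (Submodule.subset_span (Set.mem_iUnion.2 ⟨n, hx⟩))
  have hSm : MeasurableSet (𝔾 ⁻¹' (S : Set B)) := hGm hSc.measurableSet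
  have hone : Q (𝔾 ⁻¹' (S : Set B)) = 1 := by
    refine le_antisymm prob_le_one ?_
    have hlim : Tendsto (fun n : ℕ => 1 - ENNReal.ofReal (1 / ((n : ℝ) + 1))) atTop (𝓝 (1 - 0)) := by
      refine ENNReal.Tendsto.sub tendsto_const_nhds ?_ (Or.inl (by simp))
      have := ENNReal.tendsto_ofReal tendsto_one_div_add_atTop_nhds_zero_nat
      simpa using this
    rw [tsub_zero] at hlim
    exact le_of_tendsto' hlim fun n => (hK n).trans (measure_mono (Set.preimage_mono (hKS n)))
  have hae : ∀ᵐ ω ∂Q, 𝔾 ω ∈ S := (prob_compl_eq_zero_iff hSm).2 hone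
  let G : Ω → S := fun ω => if h : 𝔾 ω ∈ S then ⟨𝔾 ω, h⟩ else 0
  have hGG : ∀ᵐ ω ∂Q, (G ω : B) = 𝔾 ω := by
    filter_upwards [hae] with ω h
    simp [G, h]
  have hGmeas : Measurable G := by
    have h : Measurable fun ω => if 𝔾 ω ∈ S then 𝔾 ω else 0 :=
      Measurable.ite hSm hGm measurable_const
    have h' : Measurable fun ω => (G ω : B) := by
      convert h using 2 with ω
      by_cases hω : 𝔾 ω ∈ S <;> simp [G, hω]
    exact h'.subtype_mk (h := fun ω => (G ω).2)
  have hgs : IsGaussian (Q.map G) := by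
    refine isGaussian_of_map_eq_gaussianReal fun L => ?_
    obtain ⟨g, hg, -⟩ := exists_extension_norm_eq S L
    obtain ⟨m, v, hmv⟩ := hgauss g
    have h1 : (Q.map G).map L = gaussianReal m v := by
      rw [Measure.map_map L.continuous.measurable hGmeas, ← hmv]
      refine Measure.map_congr ?_
      filter_upwards [hGG] with ω h
      simp [← h, hg]
    exact ⟨m, v, h1⟩
  have hi : Integrable (id : S → S) (Q.map G) := IsGaussian.integrable_id
  have hi2 : Integrable G Q := hi.comp_measurable hGmeas
  exact (S.subtypeL.integrable_comp hi2).congr hGG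

/-- **Tight Gaussian processes in `ℓ∞(T)` with vanishing marginal means are centered**
(Lemma 8 of the paper). If `𝔾 : Ω → ℓ∞(T)` is a tight Borel-measurable Gaussian process
with `∫ 𝔾(ω)(t) dQ(ω) = 0` for every `t ∈ T`, then the Bochner integral `∫ 𝔾 dQ` exists and
equals `0`, and `∫ A(𝔾) dQ = 0` for every Banach space `E` and continuous linear
`A : ℓ∞(T) → E`. -/
theorem tight_gaussian_process_mean_zero
    (T : Type) (Ω : Type) [MeasurableSpace Ω] (Q : Measure Ω) [IsProbabilityMeasure Q]
    (𝔾 : Ω → lp (fun _ : T => ℝ) ∞)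
    -- `𝔾` is Borel-measurable …
    (hmeas : ∀ s : Set (lp (fun _ : T => ℝ) ∞), IsOpen s → MeasurableSet (𝔾 ⁻¹' s))
    -- … tight …
    (htight : ∀ ε : ℝ, 0 < ε → ∃ K : Set (lp (fun _ : T => ℝ) ∞),
      IsCompact K ∧ 1 - ENNReal.ofReal ε ≤ Q (𝔾 ⁻¹' K))
    -- … Gaussian: `h*(𝔾)` is a real Gaussian variable for every continuous linear functional …
    (hgauss : ∀ hstar : lp (fun _ : T => ℝ) ∞ →L[ℝ] ℝ,
      ∃ (m : ℝ) (v : ℝ≥0), Measure.map (fun ω => hstar (𝔾 ω)) Q = gaussianReal m v)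
    -- … and has vanishing marginal means
    (hzero : ∀ t : T, ∫ ω, (𝔾 ω : ∀ _ : T, ℝ) t ∂Q = 0) :
    -- conclusion: the Bochner integral of `𝔾` exists and vanishes …
    Integrable 𝔾 Q ∧ (∫ ω, 𝔾 ω ∂Q) = 0 ∧
    -- … and so does `∫ A(𝔾) dQ` for every Banach space `E` and continuous linear `A`
    ∀ (E : Type) (_ : NormedAddCommGroup E) (_ : NormedSpace ℝ E) (_ : CompleteSpace E),
      ∀ A : lp (fun _ : T => ℝ) ∞ →L[ℝ] E, (∫ ω, A (𝔾 ω) ∂Q) = 0 := by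
  have hint : Integrable 𝔾 Q := integrable_of_tight_gaussian Q 𝔾 hmeas htight hgauss
  have h0 : (∫ ω, 𝔾 ω ∂Q) = 0 := by
    ext t
    have := (lp.evalCLM ℝ (fun _ : T => ℝ) ∞ t).integral_comp_comm hint
    exact this.symm.trans (hzero t)
  refine ⟨hint, h0, ?_⟩
  intro E _ _ _ A
  rw [A.integral_comp_comm hint, h0, map_zero]
end

section
/- Let f₀ ∈ H be fixed and let (μ_n)_{n∈ℕ} be a sequence of finite (positive) Borel measures on X×Y converging weakly to a finite measure μ₀ (i.e. ∫h dμ_n → ∫h dμ₀ for every bounded continuous h, and μ_n(X×Y) → μ₀(X×Y)). Then lim_{n→∞} sup_{f∈H, ‖f‖_H ≤ 1} ‖ ∫ L''_{f₀} f Φ dμ_n − ∫ L''_{f₀} f Φ dμ₀ ‖_H = 0. -/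
open MeasureTheory Filter Classical
open scoped ENNReal Topology RealInnerProductSpace

section Helpers

lemma svm_net {H : Type} [NormedAddCommGroup H] [InnerProductSpace ℝ H] [CompleteSpace H]
    (K : Set H) (hK : IsCompact K) (δ : ℝ) (hδ : 0 < δ) :
    ∃ (m : ℕ) (e : Fin m → H), (∀ i, ‖e i‖ = 1) ∧ ∀ s ∈ K,
      ‖s - ∑ i, ⟪e i, s⟫ • e i‖ ≤ δ ∧ ‖∑ i, ⟪e i, s⟫ • e i‖ ≤ ‖s‖ := by
  obtain ⟨t, htK, htfin, hcov⟩ := hK.finite_cover_balls hδ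
  let V : Submodule ℝ H := Submodule.span ℝ t
  haveI : FiniteDimensional ℝ V := FiniteDimensional.span_of_finite ℝ htfin
  let b := stdOrthonormalBasis ℝ V
  have key : ∀ s : H, V.starProjection s = ∑ i, ⟪(b i : H), s⟫ • (b i : H) := by
    intro s
    rw [b.starProjection_eq_sum_rankOne]
    simp
  refine ⟨_, fun i => (b i : H), ?_, ?_⟩
  · intro i
    exact b.orthonormal.1 i
  · intro s hs
    simp only
    rw [← key s]
    refine ⟨?_, V.norm_starProjection_apply_le s⟩
    have := hcov hs
    simp only [Set.mem_iUnion, Metric.mem_ball] at this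
    obtain ⟨x, hx, hd⟩ := this
    rw [V.starProjection_minimal]
    refine le_trans (ciInf_le ⟨0, Set.forall_mem_range.mpr fun _ => norm_nonneg _⟩
      (⟨x, Submodule.subset_span hx⟩ : V)) ?_
    rw [dist_eq_norm] at hd
    exact hd.le

lemma svm_ae {Z : Type*} [MeasurableSpace Z] (C : Set Z) (μ : Measure Z) (h : μ Cᶜ = 0) :
    ∀ᵐ z ∂μ, z ∈ C := by
  rw [ae_iff]; exact h

lemma svm_integrable_s19 {Z : Type*} [TopologicalSpace Z] [SecondCountableTopology Z]
    [MeasurableSpace Z] [BorelSpace Z] {E : Type*} [NormedAddCommGroup E]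
    (C : Set Z) (hC : IsClosed C) (μ : Measure Z) [IsFiniteMeasure μ] (h : μ Cᶜ = 0)
    (F : Z → E) (hF : ContinuousOn F C) (B : ℝ) (hB : ∀ z ∈ C, ‖F z‖ ≤ B) :
    Integrable F μ := by
  have hr : μ.restrict C = μ := Measure.restrict_eq_self_of_ae_mem (svm_ae C μ h)
  have hm := hF.aestronglyMeasurable (μ := μ) hC.measurableSet
  rw [hr] at hm
  refine Integrable.of_bound hm B ?_
  filter_upwards [svm_ae C μ h] with z hz using hB z hz

lemma svm_tendsto {Z : Type*} [MetricSpace Z] [SecondCountableTopology Z]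
    [MeasurableSpace Z] [BorelSpace Z]
    (C : Set Z) (hC : IsClosed C) (μs : ℕ → Measure Z) (μ0 : Measure Z)
    (hs : ∀ n, μs n Cᶜ = 0) (h0 : μ0 Cᶜ = 0)
    (hweak : ∀ h : BoundedContinuousFunction Z ℝ,
      Tendsto (fun n => ∫ w, h w ∂(μs n)) atTop (𝓝 (∫ w, h w ∂μ0)))
    (ψ : Z → ℝ) (hψ : ContinuousOn ψ C) (B : ℝ) (hB : ∀ z ∈ C, ‖ψ z‖ ≤ B) :
    Tendsto (fun n => ∫ w, ψ w ∂(μs n)) atTop (𝓝 (∫ w, ψ w ∂μ0)) := by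
  let ψ' : BoundedContinuousFunction C ℝ :=
    BoundedContinuousFunction.ofNormedAddCommGroup (fun z : C => ψ z)
      (continuousOn_iff_continuous_restrict.1 hψ) B (fun z => hB z z.2)
  obtain ⟨h, -, hh⟩ := BoundedContinuousFunction.exists_extension_norm_eq_of_isClosedEmbedding
    ψ' (hC.isClosedEmbedding_subtypeVal)
  have heq : ∀ z ∈ C, h z = ψ z := fun z hz => congrFun hh ⟨z, hz⟩
  have e : ∀ μ : Measure Z, μ Cᶜ = 0 → ∫ w, h w ∂μ = ∫ w, ψ w ∂μ := by
    intro μ hμ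
    apply integral_congr_ae
    filter_upwards [svm_ae C μ hμ] with z hz using heq z hz
  have := hweak h
  simpa only [e _ (hs _), e _ h0] using this

lemma svm_abstract {Z : Type*} [MetricSpace Z] [SecondCountableTopology Z]
    [MeasurableSpace Z] [BorelSpace Z]
    {H : Type} [NormedAddCommGroup H] [InnerProductSpace ℝ H] [CompleteSpace H]
    (C : Set Z) (hC : IsClosed C) (μs : ℕ → Measure Z) (μ0 : Measure Z)
    [∀ n, IsFiniteMeasure (μs n)] [IsFiniteMeasure μ0]
    (hs : ∀ n, μs n Cᶜ = 0) (h0 : μ0 Cᶜ = 0)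
    (hweak : ∀ h : BoundedContinuousFunction Z ℝ,
      Tendsto (fun n => ∫ w, h w ∂(μs n)) atTop (𝓝 (∫ w, h w ∂μ0)))
    (hmass : Tendsto (fun n => (μs n Set.univ).toReal) atTop (𝓝 (μ0 Set.univ).toReal))
    (g : Z → ℝ) (hg : ContinuousOn g C) (B : ℝ) (hB0 : 0 ≤ B) (hB : ∀ z ∈ C, |g z| ≤ B)
    (u : Z → H) (hu : ContinuousOn u C) (κ : ℝ) (hκ0 : 0 ≤ κ) (hκ : ∀ z ∈ C, ‖u z‖ ≤ κ)
    (K : Set H) (hK : IsCompact K) (huK : ∀ z ∈ C, u z ∈ K) (ε : ℝ) (hε : 0 < ε) :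
    ∃ N : ℕ, ∀ n ≥ N, ∀ f : H, ‖f‖ ≤ 1 →
      ‖(∫ z, (g z * ⟪u z, f⟫) • u z ∂(μs n)) - ∫ z, (g z * ⟪u z, f⟫) • u z ∂μ0‖ ≤ ε := by
  set M : ℝ := (μ0 Set.univ).toReal + 1 with hM
  have hMpos : 0 < M := by positivity
  set D : ℝ := 2 * B * κ * M + 1 with hD
  have hDpos : 0 < D := by positivity
  set δ : ℝ := ε / 3 / D with hδdef
  have hδ : 0 < δ := by positivity
  obtain ⟨m, e, he1, hnet⟩ := svm_net K hK δ hδ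
  have hsmall : B * (2 * κ * δ) * M ≤ ε / 3 := by
    have : δ * D = ε / 3 := by rw [hδdef]; field_simp
    have h2 : δ * (2 * B * κ * M) ≤ δ * D := by
      apply mul_le_mul_of_nonneg_left _ hδ.le; rw [hD]; linarith
    nlinarith
  let ψ : Fin m → Fin m → Z → ℝ := fun i j z => g z * ⟪e i, u z⟫ * ⟪e j, u z⟫
  have hψc : ∀ i j, ContinuousOn (ψ i j) C := fun i j =>
    (hg.mul (continuousOn_const.inner hu)).mul (continuousOn_const.inner hu)
  have hin : ∀ i, ∀ z ∈ C, |⟪e i, u z⟫| ≤ κ := fun i z hz => by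
    refine (abs_real_inner_le_norm _ _).trans ?_
    rw [he1, one_mul]; exact hκ z hz
  have hψb : ∀ i j, ∀ z ∈ C, ‖ψ i j z‖ ≤ B * κ * κ := fun i j z hz => by
    simp only [ψ, Real.norm_eq_abs, abs_mul]
    have := hB z hz
    have := hin i z hz
    have := hin j z hz
    gcongr
  have hψt := fun i j => svm_tendsto C hC μs μ0 hs h0 hweak (ψ i j) (hψc i j) _ (hψb i j)
  have hψi : ∀ i j (μ : Measure Z) [IsFiniteMeasure μ], μ Cᶜ = 0 → Integrable (ψ i j) μ :=
    fun i j μ _ hμ => svm_integrable_s19 C hC μ hμ _ (hψc i j) _ (hψb i j)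
  -- the finite rank approximation
  let A : H → Z → H := fun f z => ∑ i, ∑ j, (ψ i j z * ⟪e i, f⟫) • e j
  have hterm : ∀ f i j (μ : Measure Z) [IsFiniteMeasure μ], μ Cᶜ = 0 →
      Integrable (fun z => (ψ i j z * ⟪e i, f⟫) • e j) μ := fun f i j μ _ hμ =>
    ((hψi i j μ hμ).mul_const _).smul_const _
  have hAi : ∀ f (μ : Measure Z) [IsFiniteMeasure μ], μ Cᶜ = 0 → Integrable (A f) μ :=
    fun f μ _ hμ => integrable_finset_sum _ fun i _ => integrable_finset_sum _ fun j _ =>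
      hterm f i j μ hμ
  have hAint : ∀ f (μ : Measure Z) [IsFiniteMeasure μ], μ Cᶜ = 0 →
      ∫ z, A f z ∂μ = ∑ i, ∑ j, ((∫ z, ψ i j z ∂μ) * ⟪e i, f⟫) • e j := by
    intro f μ _ hμ
    simp only [A]
    rw [integral_finset_sum _ fun i _ => integrable_finset_sum _ fun j _ => hterm f i j μ hμ]
    refine Finset.sum_congr rfl fun i _ => ?_
    rw [integral_finset_sum _ fun j _ => hterm f i j μ hμ]
    refine Finset.sum_congr rfl fun j _ => ?_
    rw [integral_smul_const, integral_mul_const]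
  have hAeq : ∀ f z, A f z = (g z * ⟪∑ i, ⟪e i, u z⟫ • e i, f⟫) • ∑ i, ⟪e i, u z⟫ • e i := by
    intro f z
    simp only [A, ψ, sum_inner, real_inner_smul_left, Finset.mul_sum,
      Finset.smul_sum, smul_smul]
    rw [Finset.sum_comm]
    refine Finset.sum_congr rfl fun i _ => ?_
    rw [Finset.sum_mul, Finset.sum_smul]
    refine Finset.sum_congr rfl fun j _ => ?_
    congr 1; ring
  have hclose : ∀ f, ‖f‖ ≤ 1 → ∀ z ∈ C,
      ‖(g z * ⟪u z, f⟫) • u z - A f z‖ ≤ B * (2 * κ * δ) := by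
    intro f hf z hz
    rw [hAeq]
    obtain ⟨h1, h2⟩ := hnet (u z) (huK z hz)
    set p := ∑ i, ⟪e i, u z⟫ • e i
    have hk := hκ z hz
    have : (g z * ⟪u z, f⟫) • u z - (g z * ⟪p, f⟫) • p
        = g z • (⟪u z - p, f⟫ • u z + ⟪p, f⟫ • (u z - p)) := by
      rw [inner_sub_left]; module
    rw [this, norm_smul, Real.norm_eq_abs]
    have a1 : ‖⟪u z - p, f⟫ • u z‖ ≤ δ * 1 * κ := by
      rw [norm_smul, Real.norm_eq_abs]
      have := abs_real_inner_le_norm (u z - p) f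
      refine mul_le_mul (this.trans ?_) hk (norm_nonneg _) (by positivity)
      gcongr
    have a2 : ‖⟪p, f⟫ • (u z - p)‖ ≤ κ * 1 * δ := by
      rw [norm_smul, Real.norm_eq_abs]
      have := abs_real_inner_le_norm p f
      refine mul_le_mul (this.trans ?_) h1 (norm_nonneg _) (by positivity)
      have := h2.trans hk
      gcongr
    refine mul_le_mul (hB z hz) ?_ (norm_nonneg _) hB0
    refine (norm_add_le _ _).trans ?_
    linarith
  have hFi : ∀ f, ‖f‖ ≤ 1 → ∀ (μ : Measure Z) [IsFiniteMeasure μ], μ Cᶜ = 0 →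
      Integrable (fun z => (g z * ⟪u z, f⟫) • u z) μ := by
    intro f hf μ _ hμ
    refine svm_integrable_s19 C hC μ hμ _ ((hg.mul (hu.inner continuousOn_const)).smul hu)
      (B * (κ * 1) * κ) ?_
    intro z hz
    rw [norm_smul, norm_mul, Real.norm_eq_abs, Real.norm_eq_abs]
    have hk := hκ z hz
    have := hB z hz
    have h3 : |⟪u z, f⟫| ≤ κ * 1 := (abs_real_inner_le_norm _ _).trans (by gcongr)
    gcongr
  have herr : ∀ f, ‖f‖ ≤ 1 → ∀ (μ : Measure Z) [IsFiniteMeasure μ], μ Cᶜ = 0 →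
      (μ Set.univ).toReal ≤ M →
      ‖(∫ z, (g z * ⟪u z, f⟫) • u z ∂μ) - ∫ z, A f z ∂μ‖ ≤ ε / 3 := by
    intro f hf μ _ hμ hμM
    rw [← integral_sub (hFi f hf μ hμ) (hAi f μ hμ)]
    refine le_trans (norm_integral_le_of_norm_le_const (C := B * (2 * κ * δ)) ?_) ?_
    · filter_upwards [svm_ae C μ hμ] with z hz using hclose f hf z hz
    · refine le_trans ?_ hsmall
      exact mul_le_mul_of_nonneg_left hμM (by positivity)
  have hsum : Tendsto (fun n => ∑ i, ∑ j, |(∫ z, ψ i j z ∂(μs n)) - ∫ z, ψ i j z ∂μ0|)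
      atTop (𝓝 0) := by
    have : Tendsto (fun n => ∑ i, ∑ j, |(∫ z, ψ i j z ∂(μs n)) - ∫ z, ψ i j z ∂μ0|)
        atTop (𝓝 (∑ i : Fin m, ∑ j : Fin m, |(∫ z, ψ i j z ∂μ0) - ∫ z, ψ i j z ∂μ0|)) :=
      tendsto_finset_sum _ fun i _ => tendsto_finset_sum _ fun j _ =>
        ((hψt i j).sub_const _).abs
    simpa using this
  have ev1 := hsum.eventually (ge_mem_nhds (show (0:ℝ) < ε / 3 by positivity))
  have ev2 := hmass.eventually (ge_mem_nhds (show (μ0 Set.univ).toReal < M by rw [hM]; linarith))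
  obtain ⟨N, hN⟩ := eventually_atTop.1 (ev1.and ev2)
  refine ⟨N, fun n hn f hf => ?_⟩
  obtain ⟨hn1, hn2⟩ := hN n hn
  have b1 := herr f hf (μs n) (hs n) hn2
  have b2 := herr f hf μ0 h0 (by rw [hM]; linarith)
  have b3 : ‖(∫ z, A f z ∂(μs n)) - ∫ z, A f z ∂μ0‖ ≤ ε / 3 := by
    rw [hAint f (μs n) (hs n), hAint f μ0 h0, ← Finset.sum_sub_distrib]
    refine le_trans ?_ hn1
    refine (norm_sum_le _ _).trans (Finset.sum_le_sum fun i _ => ?_)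
    rw [← Finset.sum_sub_distrib]
    refine (norm_sum_le _ _).trans (Finset.sum_le_sum fun j _ => ?_)
    rw [← sub_smul, ← sub_mul, norm_smul, he1, mul_one, norm_mul, Real.norm_eq_abs,
      Real.norm_eq_abs]
    refine mul_le_of_le_one_right (abs_nonneg _) ?_
    refine (abs_real_inner_le_norm _ _).trans ?_
    rw [he1, one_mul]; exact hf
  rw [norm_sub_rev] at b2
  have := norm_add₃_le (a := (∫ z, (g z * ⟪u z, f⟫) • u z ∂(μs n)) - ∫ z, A f z ∂(μs n))
    (b := (∫ z, A f z ∂(μs n)) - ∫ z, A f z ∂μ0)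
    (c := (∫ z, A f z ∂μ0) - ∫ z, (g z * ⟪u z, f⟫) • u z ∂μ0)
  rw [sub_add_sub_cancel, sub_add_sub_cancel] at this
  linarith

end Helpers

/-- **Continuity of `μ ↦ ∫ L''_{f₀} f Φ dμ` under weak convergence, uniformly over the unit
ball** (a step in the proof of Lemma 5 of the paper). If finite measures `μ_n` on `X × Y`
converge weakly to `μ₀` (with convergence of total masses), then
`sup_{‖f‖ ≤ 1} ‖∫ L''_{f₀} f Φ dμ_n - ∫ L''_{f₀} f Φ dμ₀‖ → 0`. -/
theorem svm_operator_weak_convergence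
    (d : ℕ) (X : Set (EuclideanSpace ℝ (Fin d))) [CompactSpace X]
    (Y : Set ℝ) (hY : IsClosed Y)
    -- the separable RKHS `H` of a continuous bounded kernel, via its feature map `Φ`
    (H : Type) [NormedAddCommGroup H] [InnerProductSpace ℝ H] [CompleteSpace H]
    [TopologicalSpace.SeparableSpace H]
    (Φ : EuclideanSpace ℝ (Fin d) → H)
    (hΦcont : ContinuousOn Φ X)
    (κ : ℝ) (hΦbdd : ∀ x ∈ X, ‖Φ x‖ ≤ κ)
    -- the loss function and its partial derivatives
    (L L' L'' : EuclideanSpace ℝ (Fin d) → ℝ → ℝ → ℝ)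
    (hLmeas : Measurable (fun q : (EuclideanSpace ℝ (Fin d) × ℝ) × ℝ => L q.1.1 q.1.2 q.2))
    (hLnonneg : ∀ x ∈ X, ∀ y ∈ Y, ∀ t : ℝ, 0 ≤ L x y t)
    (hL' : ∀ x ∈ X, ∀ y ∈ Y, ∀ t : ℝ, HasDerivAt (L x y) (L' x y t) t)
    (hL'' : ∀ x ∈ X, ∀ y ∈ Y, ∀ t : ℝ, HasDerivAt (L' x y) (L'' x y t) t)
    (hL'cont : ContinuousOn (fun q : (EuclideanSpace ℝ (Fin d) × ℝ) × ℝ => L' q.1.1 q.1.2 q.2)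
      ((X ×ˢ Y) ×ˢ (Set.univ : Set ℝ)))
    (hL''cont : ContinuousOn (fun q : (EuclideanSpace ℝ (Fin d) × ℝ) × ℝ => L'' q.1.1 q.1.2 q.2)
      ((X ×ˢ Y) ×ˢ (Set.univ : Set ℝ)))
    -- constant envelopes for `L''`
    (henv : ∀ a : ℝ, 0 < a → ∃ b'' : ℝ, 0 ≤ b'' ∧
      ∀ x ∈ X, ∀ y ∈ Y, ∀ t ∈ Set.Icc (-a) a, |L'' x y t| ≤ b'')
    -- a fixed element of `H`
    (f0 : H)
    -- a sequence of finite measures on `X × Y` converging weakly to `μ₀`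
    (μs : ℕ → Measure (EuclideanSpace ℝ (Fin d) × ℝ))
    (μ0 : Measure (EuclideanSpace ℝ (Fin d) × ℝ))
    [∀ n, IsFiniteMeasure (μs n)] [IsFiniteMeasure μ0]
    (hsupp : ∀ n, μs n ((X ×ˢ Y)ᶜ) = 0) (hsupp0 : μ0 ((X ×ˢ Y)ᶜ) = 0)
    (hweak : ∀ h : BoundedContinuousFunction (EuclideanSpace ℝ (Fin d) × ℝ) ℝ,
      Tendsto (fun n => ∫ w, h w ∂(μs n)) atTop (𝓝 (∫ w, h w ∂μ0)))
    (hmass : Tendsto (fun n => (μs n Set.univ).toReal) atTop (𝓝 (μ0 Set.univ).toReal)) :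
    -- conclusion: `sup_{‖f‖ ≤ 1} ‖∫ L''_{f₀} f Φ dμ_n - ∫ L''_{f₀} f Φ dμ₀‖ → 0`
    ∀ ε : ℝ, 0 < ε → ∃ N : ℕ, ∀ n ≥ N, ∀ f : H, ‖f‖ ≤ 1 →
      ‖(∫ z, (L'' z.1 z.2 ⟪Φ z.1, f0⟫ * ⟪Φ z.1, f⟫) • Φ z.1 ∂(μs n)) -
        ∫ z, (L'' z.1 z.2 ⟪Φ z.1, f0⟫ * ⟪Φ z.1, f⟫) • Φ z.1 ∂μ0‖ ≤ ε := by
  have hXc : IsCompact X := isCompact_iff_compactSpace.2 inferInstance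
  have hC : IsClosed (X ×ˢ Y) := hXc.isClosed.prod hY
  have hu : ContinuousOn (fun z : EuclideanSpace ℝ (Fin d) × ℝ => Φ z.1) (X ×ˢ Y) :=
    hΦcont.comp continuousOn_fst fun z hz => hz.1
  have hκ : ∀ x ∈ X, ‖Φ x‖ ≤ |κ| := fun x hx => (hΦbdd x hx).trans (le_abs_self κ)
  obtain ⟨B, hB0, hB⟩ := henv (|κ| * ‖f0‖ + 1) (by positivity)
  intro ε hε
  refine svm_abstract (X ×ˢ Y) hC μs μ0 hsupp hsupp0 hweak hmass
    (fun z => L'' z.1 z.2 ⟪Φ z.1, f0⟫) ?_ B hB0 ?_ (fun z => Φ z.1) hu |κ| (abs_nonneg _)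
    (fun z hz => hκ z.1 hz.1) (Φ '' X) (hXc.image_of_continuousOn hΦcont)
    (fun z hz => Set.mem_image_of_mem _ hz.1) ε hε
  · exact hL''cont.comp (f := fun z : EuclideanSpace ℝ (Fin d) × ℝ => (z, ⟪Φ z.1, f0⟫))
      (continuousOn_id.prodMk (hu.inner continuousOn_const)) fun z hz => ⟨hz, Set.mem_univ _⟩
  · intro z hz
    refine hB z.1 hz.1 z.2 hz.2 _ ?_
    rw [Set.mem_Icc, ← abs_le]
    refine (abs_real_inner_le_norm _ _).trans ?_
    have := mul_le_mul_of_nonneg_right (hκ z.1 hz.1) (norm_nonneg f0)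
    linarith
end
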